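/- arXiv:2007.03038 — 6 statements merged into one kernel-verified Lean document; each statement's English description precedes it below -/
import Mathlib

section
/- There exists a function g : ℕ → ℕ with limsup_{n→∞} g(n) = ∞ (i.e., g is unbounded) such that for every n ≥ 1, the g(n)(g(n)+1)/2 quadratic polynomials f_{n,i,j} with 1 ≤ i ≤ j ≤ g(n), listed in lexicographic order of (i,j), form a regular sequence in the polynomial ring A_{n,g(n)}. -/
open MvPolynomial

/-- `A_{n,m} = ℂ[x_{s,t} : 1 ≤ s ≤ n, 1 ≤ t ≤ m]`. -/
abbrev A (n m : ℕ) := MvPolynomial (Fin n × Fin m) ℂ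

/-- `f_{n,i,j} = ∑_{s=1}^n x_{s,i} x_{s,j}`. -/
noncomputable def fquad (n m : ℕ) (i j : Fin m) : A n m :=
  ∑ s : Fin n, X (s, i) * X (s, j)

/-- The quadrics `f_{n,i,j}` for `1 ≤ i ≤ j ≤ m`, listed in lexicographic
order of `(i, j)`. -/
noncomputable def Fseq (n m : ℕ) : List (A n m) :=
  (List.finRange m).flatMap fun i =>
    ((List.finRange m).filter fun j => i ≤ j).map fun j => fquad n m i j

section Filtration

variable {V R ι : Type*} [CommRing R]

/-- The polynomials all of whose monomials have weight at most `D`. -/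
noncomputable def weightLE (w : V → ℕ) (D : ℤ) : Submodule R (MvPolynomial V R) :=
  restrictSupport R {d | (Finsupp.weight w d : ℤ) ≤ D}

theorem mem_weightLE {w : V → ℕ} {D : ℤ} {p : MvPolynomial V R} :
    p ∈ weightLE w D ↔ ∀ d, coeff d p ≠ 0 → (Finsupp.weight w d : ℤ) ≤ D := by
  simp [weightLE, mem_restrictSupport_iff, Set.subset_def]

theorem weightLE_mono {w : V → ℕ} {D E : ℤ} (h : D ≤ E) :
    weightLE (R := R) w D ≤ weightLE w E :=
  fun _ hp => mem_weightLE.2 fun d hd => (mem_weightLE.1 hp d hd).trans h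

theorem mul_mem_weightLE {w : V → ℕ} {D E : ℤ} {p q : MvPolynomial V R}
    (hp : p ∈ weightLE w D) (hq : q ∈ weightLE w E) : p * q ∈ weightLE w (D + E) := by
  classical
  rw [mem_weightLE] at *
  intro d hd
  obtain ⟨a, ha, b, hb, rfl⟩ := Finset.mem_add.1 (support_mul p q (mem_support_iff.2 hd))
  have := hp a (mem_support_iff.1 ha)
  have := hq b (mem_support_iff.1 hb)
  rw [map_add]
  push_cast
  lia

theorem eq_zero_of_mem_weightLE {w : V → ℕ} {D : ℤ} {p : MvPolynomial V R}
    (hp : p ∈ weightLE w D) (hD : D < 0) : p = 0 := by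
  ext d
  by_contra h
  have := mem_weightLE.1 hp d h
  lia

theorem exists_mem_weightLE (w : V → ℕ) (p : MvPolynomial V R) :
    ∃ D : ℕ, p ∈ weightLE w (D : ℤ) :=
  ⟨p.support.sup (Finsupp.weight w), mem_weightLE.2 fun _ hd =>
    Int.ofNat_le.2 (Finset.le_sup (f := Finsupp.weight w) (mem_support_iff.2 hd))⟩

theorem C_mem_weightLE (w : V → ℕ) (c : R) : C c ∈ weightLE w 0 := by
  classical
  rw [mem_weightLE]
  intro d hd
  rw [coeff_C] at hd
  obtain rfl : 0 = d := by
    by_contra h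
    simp [h] at hd
  simp

theorem X_mem_weightLE (w : V → ℕ) (v : V) : (X v : MvPolynomial V R) ∈ weightLE w (w v) := by
  classical
  rw [mem_weightLE]
  intro d hd
  rw [coeff_X] at hd
  obtain rfl : Finsupp.single v 1 = d := by
    by_contra h
    simp [h] at hd
  simp [Finsupp.weight_single]

/-- Division of a polynomial by squares of variables of weight one, up to terms of lower weight. -/
theorem exists_sub_sum_sq_mul_mem_weightLE {w : V → ℕ} {y : ι → V} (hw : ∀ l, w (y l) = 1)
    (T : Finset ι) {D : ℤ} {h : MvPolynomial V R} (hh : h ∈ weightLE w D)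
    (hdvd : ∀ d, coeff d h ≠ 0 → (Finsupp.weight w d : ℤ) = D →
      ∃ l ∈ T, Finsupp.single (y l) 2 ≤ d) :
    ∃ u : ι → MvPolynomial V R, (∀ l, u l ∈ weightLE w (D - 2)) ∧
      h - ∑ l ∈ T, X (y l) ^ 2 * u l ∈ weightLE w (D - 1) := by
  classical
  rw [h.as_sum]
  refine Finset.sum_induction _ (fun h => ∃ u : ι → MvPolynomial V R,
    (∀ l, u l ∈ weightLE w (D - 2)) ∧ h - ∑ l ∈ T, X (y l) ^ 2 * u l ∈ weightLE w (D - 1))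
    ?_ ⟨0, by simp, by simp⟩ ?_
  · rintro a b ⟨u, hu, hua⟩ ⟨v, hv, hvb⟩
    refine ⟨u + v, fun l => add_mem (hu l) (hv l), ?_⟩
    convert! add_mem hua hvb using 1
    simp only [Pi.add_apply, mul_add, Finset.sum_add_distrib]
    ring
  · intro d hd
    rw [mem_support_iff] at hd
    have hdD := mem_weightLE.1 hh d hd
    rcases hdD.eq_or_lt with heq | hlt
    · obtain ⟨l, hl, hle⟩ := hdvd d hd heq
      refine ⟨Pi.single l (monomial (d - Finsupp.single (y l) 2) (coeff d h)), fun k => ?_, ?_⟩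
      · rcases eq_or_ne k l with rfl | hk
        · rw [Pi.single_eq_same, weightLE, monomial_mem_restrictSupport]
          left
          have := congrArg (Finsupp.weight w) (tsub_add_cancel_of_le hle)
          rw [map_add, Finsupp.weight_single, hw] at this
          simp only [Set.mem_ofPred_eq]
          simp at this
          lia
        · simp [Pi.single_eq_of_ne hk]
      · rw [Finset.sum_eq_single_of_mem l hl (fun k _ hk => by simp [Pi.single_eq_of_ne hk]),
          Pi.single_eq_same, X_pow_eq_monomial, monomial_mul, add_tsub_cancel_of_le hle]
        simp
    · refine ⟨0, by simp, ?_⟩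
      simp only [Pi.zero_apply, mul_zero, Finset.sum_const_zero, sub_zero]
      rw [weightLE, monomial_mem_restrictSupport]
      left
      simp only [Set.mem_ofPred_eq]
      lia

theorem exists_sub_sum_sq_mul_mem_weightLE_of_syzygy {w : V → ℕ} {y : ι → V}
    (hy : Function.Injective y) (hw : ∀ l, w (y l) = 1) {T : Finset ι} {k : ι} (hk : k ∉ T)
    {D : ℤ} {h : MvPolynomial V R} (hh : h ∈ weightLE w D) (g : ι → MvPolynomial V R)
    (hsyz : X (y k) ^ 2 * h - ∑ l ∈ T, X (y l) ^ 2 * g l ∈ weightLE w (D + 1)) :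
    ∃ u : ι → MvPolynomial V R, (∀ l, u l ∈ weightLE w (D - 2)) ∧
      h - ∑ l ∈ T, X (y l) ^ 2 * u l ∈ weightLE w (D - 1) := by
  refine exists_sub_sum_sq_mul_mem_weightLE hw T hh fun d hd hdD => ?_
  by_contra! hndvd
  have hc : coeff (Finsupp.single (y k) 2 + d)
      (X (y k) ^ 2 * h - ∑ l ∈ T, X (y l) ^ 2 * g l) = coeff d h := by
    rw [coeff_sub, X_pow_eq_monomial, coeff_monomial_mul, one_mul, coeff_sum,
      Finset.sum_eq_zero, sub_zero]
    intro l hl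
    rw [X_pow_eq_monomial, coeff_monomial_mul', if_neg]
    intro hle
    refine hndvd l hl ?_
    have hkl : y l ≠ y k := fun e => hk (hy e ▸ hl)
    rw [Finsupp.single_le_iff] at hle ⊢
    simpa [Finsupp.single_apply, hkl.symm] using hle
  have := mem_weightLE.1 hsyz _ (hc ▸ hd)
  rw [map_add, Finsupp.weight_single, hw] at this
  simp at this
  lia

theorem X_sq_mem_weightLE {w : V → ℕ} {v : V} (hv : w v = 1) :
    (X v ^ 2 : MvPolynomial V R) ∈ weightLE w 2 := by
  have h := X_mem_weightLE (R := R) w v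
  rw [hv] at h
  rw [sq]
  exact weightLE_mono (by norm_num) (mul_mem_weightLE h h)

theorem mem_weightLE_two {w : V → ℕ} {v : V} (hv : w v = 1) {p : MvPolynomial V R}
    (hp : p - X v ^ 2 ∈ weightLE w 1) : p ∈ weightLE w 2 := by
  rw [← sub_add_cancel p (X v ^ 2)]
  exact add_mem (weightLE_mono (by norm_num) hp) (X_sq_mem_weightLE hv)

variable {w : V → ℕ} {y : ι → V} {f : ι → MvPolynomial V R}

theorem exists_mem_weightLE_pred_sub_mem_span (hy : Function.Injective y)
    (hw : ∀ l, w (y l) = 1) (hf : ∀ l, f l - X (y l) ^ 2 ∈ weightLE w 1)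
    {T : Finset ι} {k : ι} (hk : k ∉ T)
    (hT : ∀ D : ℤ, ∀ h ∈ Ideal.span (f '' T), h ∈ weightLE w D →
      ∃ g : ι → MvPolynomial V R, (∀ l, g l ∈ weightLE w (D - 2)) ∧ h = ∑ l ∈ T, f l * g l)
    {E : ℤ} {g h : MvPolynomial V R} (hg : g ∈ weightLE w E) (hh : h ∈ weightLE w (E + 1))
    (hmem : h - f k * g ∈ Ideal.span (f '' T)) :
    ∃ g' ∈ weightLE w (E - 1), g - g' ∈ Ideal.span (f '' T) := by
  obtain ⟨a, ha, hae⟩ := hT (E + 2) _ hmem (sub_mem (weightLE_mono (by lia) hh)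
    (weightLE_mono (by lia)
      (mul_mem_weightLE (mem_weightLE_two (hw k) (hf k)) hg)))
  have hsyz : X (y k) ^ 2 * g - ∑ l ∈ T, X (y l) ^ 2 * (-a) l ∈ weightLE w (E + 1) := by
    have e : X (y k) ^ 2 * g - ∑ l ∈ T, X (y l) ^ 2 * (-a) l
        = h - (f k - X (y k) ^ 2) * g - ∑ l ∈ T, (f l - X (y l) ^ 2) * a l := by
      simp only [sub_mul, Finset.sum_sub_distrib, ← hae, Pi.neg_apply, mul_neg,
        Finset.sum_neg_distrib]
      ring
    rw [e]
    refine sub_mem (sub_mem hh ?_) (sum_mem fun l _ => ?_)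
    · exact weightLE_mono (by lia) (mul_mem_weightLE (hf k) hg)
    · exact weightLE_mono (by lia) (mul_mem_weightLE (hf l) (ha l))
  obtain ⟨u, hu, huE⟩ := exists_sub_sum_sq_mul_mem_weightLE_of_syzygy hy hw hk hg (-a) hsyz
  refine ⟨g - ∑ l ∈ T, f l * u l, ?_, ?_⟩
  · have e : g - ∑ l ∈ T, f l * u l = (g - ∑ l ∈ T, X (y l) ^ 2 * u l)
        - ∑ l ∈ T, (f l - X (y l) ^ 2) * u l := by
      simp only [sub_mul, Finset.sum_sub_distrib]
      ring
    rw [e]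
    refine sub_mem huE (sum_mem fun l _ => ?_)
    exact weightLE_mono (by lia) (mul_mem_weightLE (hf l) (hu l))
  · rw [sub_sub_cancel]
    exact sum_mem fun l hl => Ideal.mul_mem_right _ _ (Ideal.subset_span ⟨l, hl, rfl⟩)

theorem exists_eq_sum_of_mem_span (hy : Function.Injective y)
    (hw : ∀ l, w (y l) = 1) (hf : ∀ l, f l - X (y l) ^ 2 ∈ weightLE w 1) (T : Finset ι) :
    ∀ D : ℤ, ∀ h ∈ Ideal.span (f '' T), h ∈ weightLE w D →
      ∃ g : ι → MvPolynomial V R, (∀ l, g l ∈ weightLE w (D - 2)) ∧ h = ∑ l ∈ T, f l * g l := by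
  classical
  induction T using Finset.induction_on with
  | empty =>
    intro D h hh _
    exact ⟨0, by simp, by simpa using hh⟩
  | insert k T hk ih =>
    intro D h hh hD
    have key : ∀ n : ℕ, ∀ g ∈ weightLE w (D - 2 + n), h - f k * g ∈ Ideal.span (f '' T) →
        ∃ g' ∈ weightLE w (D - 2), h - f k * g' ∈ Ideal.span (f '' T) := by
      intro n
      induction n with
      | zero =>
        intro g hg hgm
        exact ⟨g, by simpa using hg, hgm⟩
      | succ n ihn =>
        intro g hg hgm
        obtain ⟨g', hg', hgg'⟩ := exists_mem_weightLE_pred_sub_mem_span hy hw hf hk ih hg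
          (weightLE_mono (by push_cast; lia) hD) hgm
        refine ihn g' (weightLE_mono (by push_cast; lia) hg') ?_
        convert! add_mem hgm (Ideal.mul_mem_left _ (f k) hgg') using 1
        ring
    rw [Finset.coe_insert, Set.image_insert_eq, Ideal.mem_span_insert] at hh
    obtain ⟨g, z, hz, hgz⟩ := hh
    obtain ⟨E, hE⟩ := exists_mem_weightLE w g
    obtain ⟨g', hg', hgm⟩ := key (E + (2 - D).toNat) g (weightLE_mono (by push_cast; lia) hE)
      (by rw [hgz]; convert! hz using 1; ring)
    obtain ⟨a, ha, hae⟩ := ih D _ hgm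
      (sub_mem hD (weightLE_mono (by lia) (
        mul_mem_weightLE (mem_weightLE_two (hw k) (hf k)) hg')))
    refine ⟨Function.update a k g', fun l => ?_, ?_⟩
    · rcases eq_or_ne l k with rfl | hl
      · simpa using hg'
      · simpa [hl] using ha l
    · rw [Finset.sum_insert hk, Function.update_self, Finset.sum_congr rfl (g := fun l => f l * a l),
        ← hae]
      · ring
      · intro l hl
        rw [Function.update_of_ne]
        rintro rfl
        exact hk hl

/-- Perturbations of squares of distinct variables by terms of lower weight are nonzerodivisors
modulo each other. -/
theorem mem_span_of_mul_mem_span (hy : Function.Injective y)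
    (hw : ∀ l, w (y l) = 1) (hf : ∀ l, f l - X (y l) ^ 2 ∈ weightLE w 1)
    {T : Finset ι} {k : ι} (hk : k ∉ T) {g : MvPolynomial V R}
    (hg : f k * g ∈ Ideal.span (f '' T)) : g ∈ Ideal.span (f '' T) := by
  have key : ∀ n : ℕ, ∀ g : MvPolynomial V R, g ∈ weightLE w ((n : ℤ) - 1) →
      f k * g ∈ Ideal.span (f '' T) → g ∈ Ideal.span (f '' T) := by
    intro n
    induction n with
    | zero =>
      intro g hgw _
      rw [eq_zero_of_mem_weightLE hgw (by norm_num)]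
      exact zero_mem _
    | succ n ihn =>
      intro g hgw hg
      obtain ⟨g', hg', hgg'⟩ := exists_mem_weightLE_pred_sub_mem_span hy hw hf hk
        (exists_eq_sum_of_mem_span hy hw hf T) hgw (zero_mem _) (by simpa using hg)
      have := ihn g' (weightLE_mono (by push_cast; lia) hg') (by
        convert! sub_mem hg (Ideal.mul_mem_left _ (f k) hgg') using 1
        ring)
      simpa using add_mem hgg' this
  obtain ⟨E, hE⟩ := exists_mem_weightLE w g
  exact key (E + 1) g (weightLE_mono (by push_cast; lia) hE) hg

end Filtration

section Shear

variable {V R : Type*} [CommRing R]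

/-- The substitution adding to each variable `v` the multiple `c v` of the variable `p v`. -/
noncomputable def shearHom (c : V → R) (p : V → V) : MvPolynomial V R →ₐ[R] MvPolynomial V R :=
  aeval fun v => X v + C (c v) * X (p v)

theorem shearHom_neg_comp {c : V → R} {p : V → V} (hc : ∀ v, c (p v) = 0) :
    (shearHom (-c) p).comp (shearHom c p) = AlgHom.id R _ := by
  refine algHom_ext fun v => ?_
  simp [shearHom, hc, algebraMap_eq]

/-- `shearHom` as an automorphism, when the variables being added are themselves fixed. -/
noncomputable def shear (c : V → R) (p : V → V) (hc : ∀ v, c (p v) = 0) :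
    MvPolynomial V R ≃ₐ[R] MvPolynomial V R :=
  AlgEquiv.ofAlgHom (shearHom c p) (shearHom (-c) p)
    (by simpa using shearHom_neg_comp (c := -c) (p := p) (by simpa using hc))
    (shearHom_neg_comp hc)

theorem shear_X (c : V → R) (p : V → V) (hc : ∀ v, c (p v) = 0) (v : V) :
    shear c p hc (X v) = X v + C (c v) * X (p v) := by
  simp [shear, shearHom]

end Shear

theorem isRegular_map_of_mem_span {S ι : Type*} [CommRing S] {F : ι → S} {L : List ι}
    (hL : L.Nodup)
    (hF : ∀ (T : Finset ι) (k : ι), k ∉ T → ∀ g : S,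
      F k * g ∈ Ideal.span (F '' T) → g ∈ Ideal.span (F '' T))
    (htop : Ideal.span (Set.range F) ≠ ⊤) :
    RingTheory.Sequence.IsRegular S (L.map F) := by
  classical
  refine ⟨⟨fun i hi => ?_⟩, fun h => htop (top_unique ?_)⟩
  · rw [isSMulRegular_quotient_iff_mem_of_smul_mem]
    intro g hg
    have hT : Ideal.ofList ((L.map F).take i) = Ideal.span (F '' (L.take i).toFinset) := by
      rw [Ideal.ofList, ← List.map_take]
      congr 1
      ext
      simp [-List.map_take]
    rw [smul_eq_mul, Ideal.mul_top] at hg ⊢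
    rw [hT] at hg ⊢
    simp only [List.length_map] at hi
    refine hF _ L[i] ?_ g (by simpa using hg)
    rw [List.mem_toFinset]
    intro hmem
    obtain ⟨j, hj, hje⟩ := List.mem_take_iff_getElem.1 hmem
    have := (hL.getElem_inj_iff).1 hje
    lia
  · rw [smul_eq_mul, Ideal.mul_top] at h
    rw [h, Ideal.ofList]
    refine Ideal.span_mono ?_
    rintro _ hx
    obtain ⟨k, _, rfl⟩ := List.mem_map.1 hx
    exact ⟨k, rfl⟩

/-- The coordinates, in the block of two rows attached to `p = (i, j)` with `i ≤ j`, of vectors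
`v_i` and `v_j` that are isotropic with `v_i ⬝ᵥ v_j = 1` if `i < j`, and of a unit vector `v_i`
if `i = j`. -/
noncomputable def blockCoeff {m : ℕ} (p : Fin m × Fin m) (k : Fin 2) (t : Fin m) : ℂ :=
  if p.1 ≤ p.2 then
    if k = 0 then if t = p.1 then 1 else if t = p.2 then 1 / 2 else 0
    else if p.1 = p.2 then 0 else if t = p.1 then Complex.I
      else if t = p.2 then -Complex.I / 2 else 0
  else 0

theorem sum_blockCoeff_mul {m : ℕ} (p : Fin m × Fin m) {i j : Fin m} (hij : i ≤ j) :
    ∑ k, blockCoeff p k i * blockCoeff p k j = if p = (i, j) then 1 else 0 := by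
  obtain ⟨a, b⟩ := p
  have hI := Complex.I_mul_I
  simp only [Fin.sum_univ_two, blockCoeff, Prod.mk.injEq]
  rcases lt_trichotomy a b with hab | rfl | hab
  · split_ifs <;> first | lia | (simp; done) | grind
  · split_ifs <;> first | lia | simp
  · split_ifs <;> first | lia | simp

section Rows

variable {n m : ℕ} (e : Fin n ≃ (Fin m × Fin m) × Fin 2)

/-- The distinguished variable of the block `p`. -/
def pivot (p : Fin m × Fin m) : Fin n × Fin m := (e.symm (p, 0), p.1)

theorem pivot_injective : Function.Injective (pivot e) := by
  intro p q h
  simpa [pivot] using congrArg (fun v : Fin n × Fin m => (e v.1).1) h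

/-- The weight that is one on the pivots of the blocks `(i, j)` with `i ≤ j`, zero elsewhere. -/
def pivotWeight (v : Fin n × Fin m) : ℕ :=
  if v = pivot e (e v.1).1 ∧ (e v.1).1.1 ≤ (e v.1).1.2 then 1 else 0

/-- The change of variables adding multiples of the pivots to the other variables. -/
noncomputable def pivotShear : A n m ≃ₐ[ℂ] A n m :=
  shear (fun v => if v = pivot e (e v.1).1 then 0 else blockCoeff (e v.1).1 (e v.1).2 v.2)
    (fun v => pivot e (e v.1).1) (fun v => by simp [pivot])

theorem pivotShear_X (v : Fin n × Fin m) :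
    ∃ z ∈ weightLE (R := ℂ) (pivotWeight e) 0, pivotShear e (X v) =
      C (blockCoeff (e v.1).1 (e v.1).2 v.2) * X (pivot e (e v.1).1) + z := by
  have hX : pivotWeight e v = 0 → (X v : A n m) ∈ weightLE (pivotWeight e) 0 := fun h => by
    simpa [h] using X_mem_weightLE (R := ℂ) (pivotWeight e) v
  rw [pivotShear, shear_X]
  by_cases hv : v = pivot e (e v.1).1
  · have h2 : (e v.1).2 = 0 := by
      rw [hv]
      simp [pivot]
    have h1 : v.2 = (e v.1).1.1 := congrArg Prod.snd hv
    by_cases hle : (e v.1).1.1 ≤ (e v.1).1.2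
    · refine ⟨0, zero_mem _, ?_⟩
      rw [← hv]
      simp [blockCoeff, hle, h1, h2]
    · refine ⟨X v, hX (by simp [pivotWeight, hle]), ?_⟩
      simp [← hv, blockCoeff, hle]
  · refine ⟨X v, hX (by simp [pivotWeight, hv]), ?_⟩
    simp [hv, add_comm]

theorem pivotShear_fquad {i j : Fin m} (hij : i ≤ j) :
    pivotShear e (fquad n m i j) - X (pivot e (i, j)) ^ 2 ∈ weightLE (pivotWeight e) 1 := by
  choose z hz hze using pivotShear_X e
  have hsq : ∑ s, C (blockCoeff (e s).1 (e s).2 i * blockCoeff (e s).1 (e s).2 j) *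
      X (pivot e (e s).1) ^ 2 = (X (pivot e (i, j)) ^ 2 : A n m) := by
    rw [e.sum_comp fun q : (Fin m × Fin m) × Fin 2 =>
      C (blockCoeff q.1 q.2 i * blockCoeff q.1 q.2 j) * (X (pivot e q.1) ^ 2 : A n m),
      Fintype.sum_prod_type]
    simp_rw [← Finset.sum_mul, ← map_sum, sum_blockCoeff_mul _ hij]
    rw [Finset.sum_eq_single (i, j)] <;> simp +contextual
  rw [fquad, map_sum, ← hsq, ← Finset.sum_sub_distrib]
  refine sum_mem fun s _ => ?_
  have hY (t : Fin m) : C (blockCoeff (e s).1 (e s).2 t) * X (pivot e (e s).1) ∈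
      weightLE (pivotWeight e) 1 := by
    refine weightLE_mono ?_ (mul_mem_weightLE (C_mem_weightLE _ _) (X_mem_weightLE _ _))
    rw [pivotWeight]
    split_ifs <;> simp
  have heq : pivotShear e (X (s, i) * X (s, j)) -
      C (blockCoeff (e s).1 (e s).2 i * blockCoeff (e s).1 (e s).2 j) * X (pivot e (e s).1) ^ 2 =
      C (blockCoeff (e s).1 (e s).2 i) * X (pivot e (e s).1) * z (s, j) +
      C (blockCoeff (e s).1 (e s).2 j) * X (pivot e (e s).1) * z (s, i) +
      z (s, i) * z (s, j) := by
    rw [map_mul, hze, hze, map_mul]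
    ring
  rw [heq]
  refine add_mem (add_mem ?_ ?_) ?_
  · exact weightLE_mono (by norm_num) (mul_mem_weightLE (hY i) (hz (s, j)))
  · exact weightLE_mono (by norm_num) (mul_mem_weightLE (hY j) (hz (s, i)))
  · exact weightLE_mono (by norm_num) (mul_mem_weightLE (hz (s, i)) (hz (s, j)))

end Rows

theorem exists_Fseq_eq_map (n m : ℕ) : ∃ L : List {p : Fin m × Fin m // p.1 ≤ p.2},
    L.Nodup ∧ Fseq n m = L.map fun p => fquad n m p.1.1 p.1.2 := by
  let L₀ : List (Fin m × Fin m) := (List.finRange m).flatMap fun i =>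
    ((List.finRange m).filter fun j => i ≤ j).map fun j => (i, j)
  have hmem : ∀ p ∈ L₀, p.1 ≤ p.2 := by
    intro p hp
    simp only [L₀, List.mem_flatMap, List.mem_map, List.mem_filter] at hp
    obtain ⟨i, _, j, ⟨_, hij⟩, rfl⟩ := hp
    simpa using hij
  have hnodup : L₀.Nodup := by
    rw [List.nodup_flatMap]
    refine ⟨fun i _ => ((List.nodup_finRange m).filter _).map (Prod.mk_right_injective i), ?_⟩
    refine (List.nodup_finRange m).imp fun {a b} hab => ?_
    simp only [Function.onFun, List.disjoint_left, List.mem_map, not_exists, not_and]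
    rintro _ ⟨j, _, rfl⟩ k _ h
    exact hab (congrArg Prod.fst h).symm
  have hF : Fseq n m = L₀.map fun p => fquad n m p.1 p.2 := by
    simp [Fseq, L₀, List.map_flatMap, Function.comp_def]
  lift L₀ to List {p : Fin m × Fin m // p.1 ≤ p.2} using hmem with L hL
  exact ⟨L, hnodup.of_map _, by rw [hF, List.map_map]; rfl⟩

theorem isRegular_Fseq {n m : ℕ} (e : Fin n ≃ (Fin m × Fin m) × Fin 2) :
    RingTheory.Sequence.IsRegular (A n m) (Fseq n m) := by
  obtain ⟨L, hL, hF⟩ := exists_Fseq_eq_map n m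
  rw [hF]
  refine isRegular_map_of_mem_span hL (fun T k hk g hg => ?_) (fun h => ?_)
  · have himage (J : Set {p : Fin m × Fin m // p.1 ≤ p.2}) :
        (Ideal.span ((fun p => fquad n m p.1.1 p.1.2) '' J)).map (pivotShear e) =
          Ideal.span ((fun p => pivotShear e (fquad n m p.1.1 p.1.2)) '' J) := by
      rw [Ideal.map_span, Set.image_image]
    have key := mem_span_of_mul_mem_span (w := pivotWeight e)
      (y := fun p : {p : Fin m × Fin m // p.1 ≤ p.2} => pivot e p.1)
      (f := fun p => pivotShear e (fquad n m p.1.1 p.1.2))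
      ((pivot_injective e).comp Subtype.val_injective)
      (fun p => by simpa [pivotWeight, pivot] using p.2)
      (fun p => pivotShear_fquad e p.2) hk (g := pivotShear e g) (by
        rw [← himage, ← map_mul]
        exact Ideal.mem_map_of_mem _ hg)
    rw [← himage, Ideal.mem_map_of_equiv] at key
    obtain ⟨x, hx, hxg⟩ := key
    rwa [← (pivotShear e).injective hxg]
  · have hle : Ideal.span (Set.range fun p : {p : Fin m × Fin m // p.1 ≤ p.2} =>
        fquad n m p.1.1 p.1.2) ≤ RingHom.ker (constantCoeff : A n m →+* ℂ) := by
      rw [Ideal.span_le]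
      rintro _ ⟨p, rfl⟩
      simp [fquad]
    rw [h] at hle
    exact RingHom.ker_ne_top _ (top_unique hle)

theorem isRegular_Fseq_zero (n : ℕ) : RingTheory.Sequence.IsRegular (A n 0) (Fseq n 0) := by
  obtain ⟨L, hL, hF⟩ := exists_Fseq_eq_map n 0
  obtain rfl : L = [] := List.eq_nil_iff_forall_not_mem.2 fun p => p.1.1.elim0
  rw [hF]
  exact RingTheory.Sequence.IsRegular.nil _ _

theorem stmt0 :
    ∃ g : ℕ → ℕ,
      Filter.limsup (fun n => (g n : ℕ∞)) Filter.atTop = ⊤ ∧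
      ∀ n : ℕ, 1 ≤ n → RingTheory.Sequence.IsRegular (A n (g n)) (Fseq n (g n)) := by
  classical
  let g : ℕ → ℕ := fun n => if m : ∃ m, n = m * m * 2 then m.choose else 0
  have hg (m : ℕ) : g (m * m * 2) = m := by
    have hex : ∃ k, m * m * 2 = k * k * 2 := ⟨m, rfl⟩
    simp only [g, dif_pos hex]
    have := hex.choose_spec
    exact (Nat.mul_self_inj.1 (by lia)).symm
  refine ⟨g, ?_, fun n _ => ?_⟩
  · rw [ENat.eq_top_iff_forall_ge]
    intro b
    refine Filter.le_limsup_of_frequently_le (Filter.frequently_atTop.2 fun a => ?_)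
    refine ⟨(a + b) * (a + b) * 2, by nlinarith, ?_⟩
    rw [hg]
    exact_mod_cast Nat.le_add_left b a
  · by_cases hn : ∃ m, n = m * m * 2
    · obtain ⟨m, rfl⟩ := hn
      rw [hg]
      exact isRegular_Fseq (Fintype.equivOfCardEq (by simp))
    · rw [show g n = 0 from dif_neg hn]
      exact isRegular_Fseq_zero n
end

section
/- For every positive integer k there exists a positive integer n such that the k(k+1)/2 quadratic polynomials f_{n,i,j} with 1 ≤ i ≤ j ≤ k, listed in lexicographic order of (i,j), form a regular sequence in the polynomial ring A_{n,k}. -/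
open MvPolynomial

universe u

namespace MonomialOrder

open scoped MonomialOrder

variable {σ : Type*}

theorem nonempty_of_finite (σ : Type u) [Finite σ] : Nonempty (MonomialOrder.{u, u} σ) := by
  classical
  let _ : LinearOrder σ := linearOrderOfSTO WellOrderingRel
  exact ⟨MonomialOrder.lex⟩

/-- The pair formed by the weighted degree and the image under `m.toSyn`. -/
noncomputable def weightProd (m : MonomialOrder σ) (w : σ → ℕ) : (σ →₀ ℕ) →+ ℕ ×ₗ m.syn where
  toFun d := toLex (Finsupp.weight w d, m.toSyn d)
  map_zero' := by simp only [map_zero]; rfl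
  map_add' c d := by simp only [map_add]; rfl

theorem weightProd_leftInverse (m : MonomialOrder σ) (w : σ → ℕ) :
    Function.LeftInverse (fun x : ℕ ×ₗ m.syn => m.toSyn.symm (ofLex x).2) (m.weightProd w) :=
  fun d => by simp [weightProd]

/-- The monomial order that compares weighted degrees first and breaks ties with `m`. -/
noncomputable def weighted (m : MonomialOrder σ) (w : σ → ℕ) : MonomialOrder σ where
  syn := AddMonoidHom.mrange (m.weightProd w)
  toSyn := AddEquiv.ofLeftInverse' _ (m.weightProd_leftInverse w)
  toSyn_monotone c d h := by
    change m.weightProd w c ≤ m.weightProd w d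
    refine Prod.Lex.toLex_mono ⟨?_, m.toSyn_monotone h⟩
    obtain ⟨e, rfl⟩ := exists_add_of_le h
    simp

theorem weighted_lt_of_weight_lt (m : MonomialOrder σ) {w : σ → ℕ} {c d : σ →₀ ℕ}
    (h : Finsupp.weight w c < Finsupp.weight w d) : c ≺[m.weighted w] d := by
  change m.weightProd w c < m.weightProd w d
  exact Prod.Lex.toLex_lt_toLex.mpr (Or.inl h)

variable (m : MonomialOrder σ)

theorem degree_eq_of_forall_le {R : Type*} [CommSemiring R] {f : MvPolynomial σ R} {d : σ →₀ ℕ}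
    (hd : d ∈ f.support) (h : ∀ c ∈ f.support, c ≼[m] d) : m.degree f = d :=
  m.toSyn.injective (le_antisymm (m.degree_le_iff.mpr h) (m.le_degree hd))

theorem _root_.Finsupp.le_of_le_add_of_disjoint {a b c : σ →₀ ℕ}
    (hac : Disjoint a.support c.support) (h : a ≤ b + c) : a ≤ b := by
  intro s
  have hs := h s
  by_cases ha : a s = 0
  · simp [ha]
  · have hc : c s = 0 := by
      simpa using Finset.disjoint_left.mp hac (Finsupp.mem_support_iff.mpr ha)
    simpa [hc] using hs

variable {K : Type*} [Field K]

/-- Every nonzero element of the ideal generated by `rs` has its leading monomial divisible by the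
leading monomial of a member of `rs`. -/
def IsGroebnerList (rs : List (MvPolynomial σ K)) : Prop :=
  ∀ g ∈ Ideal.ofList rs, g ≠ 0 → ∃ f ∈ rs, m.degree f ≤ m.degree g

variable {m}

theorem exists_sub_mem_ofList {rs : List (MvPolynomial σ K)} (h0 : ∀ f ∈ rs, m.degree f ≠ 0)
    (h : MvPolynomial σ K) :
    ∃ r, h - r ∈ Ideal.ofList rs ∧ (r ≠ 0 → ∀ f ∈ rs, ¬ m.degree f ≤ m.degree r) := by
  obtain ⟨g, r, hgr, -, hr⟩ := m.div_set (B := {f | f ∈ rs})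
    (fun b hb => m.isUnit_leadingCoeff.mpr (m.ne_zero_of_degree_ne_zero (h0 b hb))) h
  refine ⟨r, ?_, fun hr0 => hr _ (m.degree_mem_support hr0)⟩
  rw [hgr, add_sub_cancel_right, Finsupp.linearCombination_apply]
  exact Ideal.sum_mem _ fun b _ => Ideal.mul_mem_left _ _ (Ideal.subset_span b.2)

theorem not_degree_le_degree_mul {f r p : MvPolynomial σ K} (hf : f ≠ 0) (hr : r ≠ 0)
    (hpf : Disjoint (m.degree p).support (m.degree f).support)
    (h : ¬ m.degree p ≤ m.degree r) : ¬ m.degree p ≤ m.degree (r * f) := by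
  rw [m.degree_mul hr hf]
  exact fun h' => h (Finsupp.le_of_le_add_of_disjoint hpf h')

theorem IsGroebnerList.concat {rs : List (MvPolynomial σ K)} (hrs : m.IsGroebnerList rs)
    (h0 : ∀ f ∈ rs, m.degree f ≠ 0) {f : MvPolynomial σ K} (hf : f ≠ 0)
    (hd : ∀ p ∈ rs, Disjoint (m.degree p).support (m.degree f).support) :
    m.IsGroebnerList (rs ++ [f]) := by
  intro g hg hg0
  rw [Ideal.ofList_append, Ideal.ofList_singleton] at hg
  obtain ⟨p, hp, q, hq, rfl⟩ := Submodule.mem_sup.mp hg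
  obtain ⟨h, rfl⟩ := Ideal.mem_span_singleton'.mp hq
  obtain ⟨r, hr, hr'⟩ := exists_sub_mem_ofList h0 h
  have hp' : p + (h - r) * f ∈ Ideal.ofList rs := add_mem hp (Ideal.mul_mem_right _ _ hr)
  have heq : p + h * f = (p + (h - r) * f) + r * f := by ring
  rw [heq] at hg0 ⊢
  generalize p + (h - r) * f = p' at hp' hg0
  by_cases hr0 : r = 0
  · subst hr0
    simp only [zero_mul, add_zero] at hg0 ⊢
    obtain ⟨b, hb, hle⟩ := hrs p' hp' hg0
    exact ⟨b, by simp [hb], hle⟩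
  have hle : m.degree f ≤ m.degree (r * f) := by
    rw [m.degree_mul hr0 hf]
    exact le_add_self
  by_cases hp0 : p' = 0
  · exact ⟨f, by simp, by simpa [hp0] using hle⟩
  obtain ⟨b, hb, hb'⟩ := hrs p' hp' hp0
  have hne : m.degree p' ≠ m.degree (r * f) := fun h' =>
    not_degree_le_degree_mul hf hr0 (hd b hb) (hr' hr0 b hb) (h' ▸ hb')
  rcases lt_or_gt_of_ne (m.toSyn.injective.ne hne) with hlt | hlt
  · exact ⟨f, by simp, by rwa [m.degree_add_eq_right_of_lt hlt]⟩
  · exact ⟨b, by simp [hb], by rwa [m.degree_add_of_lt hlt]⟩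

theorem IsGroebnerList.mem_of_mul_mem {rs : List (MvPolynomial σ K)} (hrs : m.IsGroebnerList rs)
    (h0 : ∀ f ∈ rs, m.degree f ≠ 0) {f : MvPolynomial σ K} (hf : f ≠ 0)
    (hd : ∀ p ∈ rs, Disjoint (m.degree p).support (m.degree f).support)
    {h : MvPolynomial σ K} (hh : h * f ∈ Ideal.ofList rs) : h ∈ Ideal.ofList rs := by
  obtain ⟨r, hr, hr'⟩ := exists_sub_mem_ofList h0 h
  suffices r = 0 by simpa [this] using hr
  by_contra hr0
  have hrf : r * f ∈ Ideal.ofList rs := by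
    have := sub_mem hh (Ideal.mul_mem_right f _ hr)
    rwa [sub_mul, sub_sub_cancel] at this
  obtain ⟨b, hb, hb'⟩ := hrs _ hrf (mul_ne_zero hr0 hf)
  exact not_degree_le_degree_mul hf hr0 (hd b hb) (hr' hr0 b hb) hb'

theorem isGroebnerList_of_pairwise_disjoint {rs : List (MvPolynomial σ K)}
    (h0 : ∀ f ∈ rs, m.degree f ≠ 0)
    (hd : rs.Pairwise fun f g => Disjoint (m.degree f).support (m.degree g).support) :
    m.IsGroebnerList rs := by
  induction rs using List.reverseRecOn with
  | nil => intro g hg hg0; simp_all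
  | append_singleton rs f ih =>
    rw [List.pairwise_append] at hd
    have h0' : ∀ p ∈ rs, m.degree p ≠ 0 := fun p hp => h0 p (by simp [hp])
    exact (ih h0' hd.1).concat h0' (m.ne_zero_of_degree_ne_zero (h0 f (by simp)))
      fun p hp => hd.2.2 p hp f (by simp)

/-- Nonconstant polynomials with pairwise coprime leading monomials form a regular sequence. -/
theorem isRegular_of_pairwise_disjoint {rs : List (MvPolynomial σ K)}
    (h0 : ∀ f ∈ rs, m.degree f ≠ 0)
    (hd : rs.Pairwise fun f g => Disjoint (m.degree f).support (m.degree g).support) :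
    RingTheory.Sequence.IsRegular (MvPolynomial σ K) rs where
  regular_mod_prev i hi := by
    have hsub : ∀ p ∈ rs.take i, p ∈ rs := fun p => List.mem_of_mem_take
    have h0' : ∀ p ∈ rs.take i, m.degree p ≠ 0 := fun p hp => h0 p (hsub p hp)
    have hG : m.IsGroebnerList (rs.take i) :=
      isGroebnerList_of_pairwise_disjoint h0' (hd.sublist (List.take_sublist i rs))
    have hdi : ∀ p ∈ rs.take i, Disjoint (m.degree p).support (m.degree rs[i]).support := by
      intro p hp
      rw [← List.take_append_drop i rs, List.pairwise_append] at hd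
      refine hd.2.2 p hp _ ?_
      rw [List.drop_eq_getElem_cons hi]
      exact List.mem_cons_self
    rw [isSMulRegular_iff_right_eq_zero_of_smul]
    intro x
    obtain ⟨h, rfl⟩ := Submodule.Quotient.mk_surjective _ x
    rw [← Submodule.Quotient.mk_smul, Submodule.Quotient.mk_eq_zero,
      Submodule.Quotient.mk_eq_zero, smul_eq_mul, Ideal.mul_top, smul_eq_mul, mul_comm]
    exact hG.mem_of_mul_mem h0' (m.ne_zero_of_degree_ne_zero (h0 _ (List.getElem_mem hi))) hdi
  top_ne_smul h := by
    rw [smul_eq_mul, Ideal.mul_top] at h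
    obtain ⟨f, hf, hf'⟩ := isGroebnerList_of_pairwise_disjoint h0 hd 1
      (h ▸ Submodule.mem_top) one_ne_zero
    exact h0 f hf (by simpa using hf')

end MonomialOrder

/-- The pairs `(i, j)` with `i ≤ j`, in lexicographic order. -/
def orderedPairs (k : ℕ) : List (Fin k × Fin k) :=
  (List.finRange k).flatMap fun i => ((List.finRange k).filter fun j => i ≤ j).map fun j => (i, j)

theorem mem_orderedPairs {k : ℕ} {p : Fin k × Fin k} : p ∈ orderedPairs k ↔ p.1 ≤ p.2 := by
  obtain ⟨i, j⟩ := p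
  simp [orderedPairs]

theorem orderedPairs_nodup (k : ℕ) : (orderedPairs k).Nodup := by
  refine List.pairwise_flatMap.mpr ⟨fun i _ => ?_, ?_⟩
  · exact ((List.nodup_finRange k).filter _).map (Prod.mk_right_injective i)
  · refine (List.nodup_finRange k).imp fun {a b} hab x hx y hy => ?_
    simp only [List.mem_map] at hx hy
    obtain ⟨_, -, rfl⟩ := hx
    obtain ⟨_, -, rfl⟩ := hy
    simp [hab]

theorem Fseq_eq_map (n k : ℕ) :
    Fseq n k = (orderedPairs k).map fun p => fquad n k p.1 p.2 := by
  simp [Fseq, orderedPairs, List.map_flatMap, Function.comp_def]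

/-- The exponent of `x_{s,i} x_{s,j}`. -/
noncomputable def quadExponent {n k : ℕ} (s : Fin n) (i j : Fin k) : Fin n × Fin k →₀ ℕ :=
  Finsupp.single (s, i) 1 + Finsupp.single (s, j) 1

theorem quadExponent_apply_ne_zero {n k : ℕ} {s t : Fin n} {i j l : Fin k}
    (h : quadExponent s i j (t, l) ≠ 0) : s = t := by
  by_contra hst
  simp [quadExponent, hst] at h

theorem quadExponent_ne_zero {n k : ℕ} (s : Fin n) (i j : Fin k) : quadExponent s i j ≠ 0 := by
  simp [quadExponent]

theorem quadExponent_eq_iff {n k : ℕ} {s t : Fin n} {i j : Fin k} :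
    quadExponent s i j = quadExponent t i j ↔ s = t := by
  refine ⟨fun h => ?_, fun h => h ▸ rfl⟩
  refine (quadExponent_apply_ne_zero (l := i) (h ▸ ?_ : quadExponent s i j (t, i) ≠ 0))
  simp [quadExponent]

theorem fquad_eq_sum_monomial (n k : ℕ) (i j : Fin k) :
    fquad n k i j = ∑ s : Fin n, monomial (quadExponent s i j) (1 : ℂ) := by
  simp [fquad, quadExponent, X, monomial_mul]

theorem mem_support_fquad {n k : ℕ} {i j : Fin k} {d : Fin n × Fin k →₀ ℕ} :
    d ∈ (fquad n k i j).support ↔ ∃ s, d = quadExponent s i j := by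
  constructor
  · intro h
    by_contra! hd
    refine mem_support_iff.mp h ?_
    simp only [fquad_eq_sum_monomial, coeff_sum, coeff_monomial]
    exact Finset.sum_eq_zero fun s _ => if_neg (hd s).symm
  · rintro ⟨s, rfl⟩
    simp [fquad_eq_sum_monomial, coeff_sum, coeff_monomial, quadExponent_eq_iff]

/-- The row index assigned to the pair `(i, j)` carries the weights that single out
`x_{s,i} x_{s,j}`; diagonal pairs are weighted more heavily. -/
def pairWeight (k : ℕ) (v : Fin (k * k) × Fin k) : ℕ :=
  let p := finProdFinEquiv.symm v.1
  if p.1 = p.2 then (if v.2 = p.1 then 3 else 0)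
  else (if p.1 < p.2 ∧ (v.2 = p.1 ∨ v.2 = p.2) then 2 else 0)

theorem weight_quadExponent {n k : ℕ} (w : Fin n × Fin k → ℕ) (s : Fin n) (i j : Fin k) :
    Finsupp.weight w (quadExponent s i j) = w (s, i) + w (s, j) := by
  simp [quadExponent, Finsupp.weight_single]

theorem pairWeight_lt {k : ℕ} {i j : Fin k} (hij : i ≤ j) {s : Fin (k * k)}
    (hs : s ≠ finProdFinEquiv (i, j)) :
    pairWeight k (s, i) + pairWeight k (s, j) <
      pairWeight k (finProdFinEquiv (i, j), i) + pairWeight k (finProdFinEquiv (i, j), j) := by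
  obtain ⟨⟨a, b⟩, rfl⟩ := finProdFinEquiv.surjective s
  have hab : ¬ (a = i ∧ b = j) := by rintro ⟨rfl, rfl⟩; exact hs rfl
  simp only [pairWeight, Equiv.symm_apply_apply]
  split_ifs <;> grind

theorem exists_degree_fquad (k : ℕ) :
    ∃ m : MonomialOrder.{0, 0} (Fin (k * k) × Fin k), ∀ i j : Fin k,
      i ≤ j → m.degree (fquad (k * k) k i j) = quadExponent (finProdFinEquiv (i, j)) i j := by
  obtain ⟨m⟩ := MonomialOrder.nonempty_of_finite (Fin (k * k) × Fin k)
  refine ⟨m.weighted (pairWeight k), fun i j hij => ?_⟩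
  refine MonomialOrder.degree_eq_of_forall_le _ (mem_support_fquad.mpr ⟨_, rfl⟩) fun c hc => ?_
  obtain ⟨s, rfl⟩ := mem_support_fquad.mp hc
  by_cases hs : s = finProdFinEquiv (i, j)
  · rw [hs]
  · refine (m.weighted_lt_of_weight_lt ?_).le
    simpa only [weight_quadExponent] using pairWeight_lt hij hs

theorem stmt1 (k : ℕ) (hk : 0 < k) :
    ∃ n : ℕ, 0 < n ∧ RingTheory.Sequence.IsRegular (A n k) (Fseq n k) := by
  obtain ⟨m, hm⟩ := exists_degree_fquad k
  refine ⟨k * k, Nat.mul_pos hk hk, MonomialOrder.isRegular_of_pairwise_disjoint (m := m) ?_ ?_⟩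
  · intro f hf
    rw [Fseq_eq_map, List.mem_map] at hf
    obtain ⟨p, hp, rfl⟩ := hf
    rw [hm _ _ (mem_orderedPairs.mp hp)]
    exact quadExponent_ne_zero _ _ _
  · rw [Fseq_eq_map, List.pairwise_map]
    refine (orderedPairs_nodup k).imp_of_mem fun {p q} hp hq hpq => ?_
    rw [hm _ _ (mem_orderedPairs.mp hp), hm _ _ (mem_orderedPairs.mp hq),
      Finset.disjoint_left]
    rintro ⟨t, l⟩ h₁ h₂
    rw [Finsupp.mem_support_iff] at h₁ h₂
    exact hpq (finProdFinEquiv.injective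
      ((quadExponent_apply_ne_zero h₁).trans (quadExponent_apply_ne_zero h₂).symm))
end

section
/- For every positive integer n, setting m = ⌊n/2⌋, the m(m+1)/2 quadratic polynomials f_{n,i,j} with 1 ≤ i ≤ j ≤ m, listed in lexicographic order of (i,j), form a regular sequence in the polynomial ring A_{n,m}. -/
open MvPolynomial

namespace WeightFiltration

variable {σ R : Type*} [CommRing R]

/-- The homogenization `X i ↦ X i * T ^ w i` of a polynomial with respect to the weight `w`. -/
noncomputable def homogenize (w : σ → ℕ) :
    MvPolynomial σ R →ₐ[R] Polynomial (MvPolynomial σ R) :=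
  aeval fun i => Polynomial.C (X i) * Polynomial.X ^ w i

/-- `a` has weight at most `d`, and its component of weight `d` is `g`. -/
def HasTop (w : σ → ℕ) (a : MvPolynomial σ R) (d : ℕ) (g : MvPolynomial σ R) : Prop :=
  (homogenize w a).natDegree ≤ d ∧ (homogenize w a).coeff d = g

variable {w : σ → ℕ} {a b f g h : MvPolynomial σ R} {d e : ℕ}

lemma eval_one_homogenize (a : MvPolynomial σ R) : (homogenize w a).eval 1 = a := by
  induction a using MvPolynomial.induction_on with
  | C r => simp [homogenize, Polynomial.algebraMap_apply, MvPolynomial.algebraMap_eq]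
  | add p q hp hq => simp [hp, hq]
  | mul_X p i hp => rw [map_mul, Polynomial.eval_mul, hp]; simp [homogenize]

lemma homogenize_monomial (s : σ →₀ ℕ) (r : R) :
    homogenize w (monomial s r) =
      Polynomial.C (monomial s r) * Polynomial.X ^ Finsupp.weight w s := by
  classical
  rw [homogenize, aeval_monomial, Finsupp.prod, monomial_eq, Finsupp.prod, Finsupp.weight_apply,
    Finsupp.sum, ← Finset.prod_pow_eq_pow_sum, map_mul, map_prod, mul_assoc,
    ← Finset.prod_mul_distrib]
  congr 1
  refine Finset.prod_congr rfl fun i _ => ?_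
  rw [mul_pow, ← pow_mul, smul_eq_mul, mul_comm (w i), map_pow]

lemma homogenize_coeff (a : MvPolynomial σ R) (d : ℕ) :
    homogenize w ((homogenize w a).coeff d) =
      Polynomial.C ((homogenize w a).coeff d) * Polynomial.X ^ d := by
  induction a using MvPolynomial.induction_on' with
  | monomial s r =>
    rw [homogenize_monomial, Polynomial.coeff_C_mul, Polynomial.coeff_X_pow]
    split_ifs with hd
    · rw [mul_one, homogenize_monomial, hd]
    · simp
  | add p q hp hq => rw [map_add, Polynomial.coeff_add, map_add, hp, hq, map_add, add_mul]

lemma HasTop.add (ha : HasTop w a d g) (hb : HasTop w b d h) : HasTop w (a + b) d (g + h) := by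
  refine ⟨?_, by rw [map_add, Polynomial.coeff_add, ha.2, hb.2]⟩
  rw [map_add]
  exact Polynomial.natDegree_add_le_of_degree_le ha.1 hb.1

lemma HasTop.sub (ha : HasTop w a d g) (hb : HasTop w b d h) : HasTop w (a - b) d (g - h) := by
  refine ⟨?_, by rw [map_sub, Polynomial.coeff_sub, ha.2, hb.2]⟩
  rw [map_sub]
  exact (Polynomial.natDegree_sub_le_of_le ha.1 hb.1).trans (max_self d).le

lemma HasTop.mul (ha : HasTop w a d g) (hb : HasTop w b e h) :
    HasTop w (a * b) (d + e) (g * h) := by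
  refine ⟨?_, ?_⟩ <;> rw [map_mul]
  · exact Polynomial.natDegree_mul_le_of_le ha.1 hb.1
  · rw [Polynomial.coeff_mul_add_eq_of_natDegree_le ha.1 hb.1, ha.2, hb.2]

lemma hasTop_zero : HasTop w (0 : MvPolynomial σ R) d 0 := by
  simp [HasTop]

lemma HasTop.sum {ι : Type*} (s : Finset ι) {a g : ι → MvPolynomial σ R}
    (ha : ∀ i ∈ s, HasTop w (a i) d (g i)) : HasTop w (∑ i ∈ s, a i) d (∑ i ∈ s, g i) := by
  classical
  induction s using Finset.induction_on with
  | empty => simpa using hasTop_zero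
  | insert i s hi ih =>
    rw [Finset.sum_insert hi, Finset.sum_insert hi]
    exact (ha i (by simp)).add (ih fun j hj => ha j (by simp [hj]))

lemma hasTop_X (i : σ) : HasTop w (X i : MvPolynomial σ R) (w i) (X i) := by
  refine ⟨?_, ?_⟩ <;> rw [homogenize, aeval_X]
  · exact Polynomial.natDegree_C_mul_X_pow_le _ _
  · simp

lemma HasTop.C_mul (ha : HasTop w a d g) (r : R) : HasTop w (C r * a) d (C r * g) := by
  have hC : HasTop w (C r) 0 (C r) := by
    rw [HasTop, homogenize, algHom_C, Polynomial.algebraMap_apply, MvPolynomial.algebraMap_eq]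
    simp
  simpa using hC.mul ha

lemma HasTop.of_lt (ha : HasTop w a d g) (hd : d < e) : HasTop w a e 0 :=
  ⟨ha.1.trans hd.le, Polynomial.coeff_eq_zero_of_natDegree_lt (ha.1.trans_lt hd)⟩

lemma HasTop.of_le (ha : HasTop w a d g) (hd : d ≤ e) :
    HasTop w a e ((homogenize w a).coeff e) :=
  ⟨ha.1.trans hd, rfl⟩

/-- `J` is the ideal of top-weight components of elements of `I`. -/
structure IsTopIdeal (w : σ → ℕ) (I J : Ideal (MvPolynomial σ R)) : Prop where
  top_mem : ∀ ⦃a d g⦄, a ∈ I → HasTop w a d g → g ∈ J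
  lift : ∀ ⦃c⦄, c ∈ J → ∀ d, ∃ b ∈ I, HasTop w b d ((homogenize w c).coeff d)

lemma isTopIdeal_bot : IsTopIdeal w (⊥ : Ideal (MvPolynomial σ R)) ⊥ where
  top_mem := by
    rintro a d g ha ⟨-, rfl⟩
    simp [(Submodule.mem_bot _).1 ha]
  lift := by
    intro c hc d
    exact ⟨0, zero_mem _, by simpa [(Submodule.mem_bot _).1 hc] using hasTop_zero⟩

variable {I J : Ideal (MvPolynomial σ R)}

lemma eq_zero_of_coeff_eq_zero (ha : ∀ k, (homogenize w a).coeff k = 0) : a = 0 := by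
  have h0 : homogenize w a = 0 := Polynomial.ext fun k => by rw [ha k, Polynomial.coeff_zero]
  rw [← eval_one_homogenize (w := w) a, h0, Polynomial.eval_zero]

/-- An element with top component in `J` can be modified by an element of `I` so as to lower
its weight. -/
lemma IsTopIdeal.exists_sub (hIJ : IsTopIdeal w I J) (ha : HasTop w a d g) (hg : g ∈ J) :
    ∃ b ∈ I, HasTop w b d g ∧ ∀ k, d ≤ k → (homogenize w (a - b)).coeff k = 0 := by
  obtain ⟨b, hb, hbd⟩ := hIJ.lift hg d
  have hgg : (homogenize w g).coeff d = g := by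
    rw [← ha.2, homogenize_coeff]
    simp
  rw [hgg] at hbd
  refine ⟨b, hb, hbd, fun k hk => ?_⟩
  have h := ha.sub hbd
  rcases hk.eq_or_lt with rfl | hk
  · rw [h.2, sub_self]
  · exact Polynomial.coeff_eq_zero_of_natDegree_lt (h.1.trans_lt hk)

lemma hasTop_of_coeff_eq_zero (ha : ∀ k, d + 1 ≤ k → (homogenize w a).coeff k = 0) :
    HasTop w a d ((homogenize w a).coeff d) :=
  ⟨Polynomial.natDegree_le_iff_coeff_eq_zero.2 ha, rfl⟩

lemma exists_coeff_eq_zero (a : MvPolynomial σ R) :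
    ∃ n, ∀ k, n ≤ k → (homogenize w a).coeff k = 0 :=
  ⟨(homogenize w a).natDegree + 1, fun _ hk => Polynomial.coeff_eq_zero_of_natDegree_lt hk⟩

/-- A nonzerodivisor modulo the top ideal lifts to a nonzerodivisor. -/
lemma IsTopIdeal.mem_of_mul_mem (hIJ : IsTopIdeal w I J) (hf : HasTop w f d g)
    (hg : ∀ c, c * g ∈ J → c ∈ J) (ha : a * f ∈ I) : a ∈ I := by
  obtain ⟨n, hn⟩ := exists_coeff_eq_zero (w := w) a
  induction n generalizing a with
  | zero => simp [eq_zero_of_coeff_eq_zero fun k => hn k (Nat.zero_le k)]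
  | succ n ih =>
    have hat := hasTop_of_coeff_eq_zero hn
    obtain ⟨b, hb, -, hab⟩ := hIJ.exists_sub hat (hg _ (hIJ.top_mem ha (hat.mul hf)))
    have : a - b ∈ I := ih (by rw [sub_mul]; exact sub_mem ha (I.mul_mem_right _ hb)) hab
    simpa using add_mem this hb

/-- The formation of top ideals is compatible with adjoining an element whose top component is
a nonzerodivisor modulo the top ideal. -/
lemma IsTopIdeal.sup_span (hIJ : IsTopIdeal w I J) (hf : HasTop w f d g)
    (hg : ∀ c, c * g ∈ J → c ∈ J) :
    IsTopIdeal w (I ⊔ Ideal.span {f}) (J ⊔ Ideal.span {g}) where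
  top_mem := by
    intro a D t ha hat
    obtain ⟨b, hb, y, hy, rfl⟩ := Submodule.mem_sup.1 ha
    obtain ⟨c, rfl⟩ := Ideal.mem_span_singleton'.1 hy
    clear ha hy
    obtain ⟨n, hn⟩ := exists_coeff_eq_zero (w := w) c
    induction n generalizing b c with
    | zero =>
      rw [eq_zero_of_coeff_eq_zero fun k => hn k (Nat.zero_le k), zero_mul, add_zero] at hat
      exact Ideal.mem_sup_left (hIJ.top_mem hb hat)
    | succ n ih =>
      have hct := hasTop_of_coeff_eq_zero hn
      rcases le_or_gt (n + d) D with hD | hD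
      · have hct' := hct.of_le (Nat.le_sub_of_add_le hD)
        have hcf := hct'.mul hf
        rw [Nat.sub_add_cancel (by omega)] at hcf
        have hbt := hat.sub hcf
        rw [add_sub_cancel_right] at hbt
        have := add_mem (Ideal.mem_sup_left (T := Ideal.span {g}) (hIJ.top_mem hb hbt))
          (Ideal.mem_sup_right (Ideal.mem_span_singleton'.2
            ⟨(homogenize w c).coeff (D - d), rfl⟩))
        rwa [sub_add_cancel] at this
      · have hcf := hct.mul hf
        have hbt := (hat.of_lt hD).sub hcf
        rw [add_sub_cancel_right, zero_sub] at hbt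
        have htop := hIJ.top_mem hb hbt
        rw [neg_mem_iff] at htop
        obtain ⟨e, he, -, hce⟩ := hIJ.exists_sub hct (hg _ htop)
        have hbc : b + e * f + (c - e) * f = b + c * f := by
          rw [sub_mul, add_assoc, add_sub_cancel]
        rw [← hbc] at hat
        exact ih (b + e * f) (add_mem hb (I.mul_mem_right f he)) (c - e) hat hce
  lift := by
    intro c hc D
    obtain ⟨x, hx, y, hy, rfl⟩ := Submodule.mem_sup.1 hc
    obtain ⟨u, rfl⟩ := Ideal.mem_span_singleton'.1 hy
    obtain ⟨b, hb, hbt⟩ := hIJ.lift hx D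
    have hgh : homogenize w g = Polynomial.C g * Polynomial.X ^ d := by
      rw [← hf.2, homogenize_coeff]
    rw [map_add, Polynomial.coeff_add, map_mul, hgh, ← mul_assoc, Polynomial.coeff_mul_X_pow']
    split_ifs with hD
    · refine ⟨b + (homogenize w u).coeff (D - d) * f, add_mem (Ideal.mem_sup_left hb)
        (Ideal.mem_sup_right (Ideal.mem_span_singleton'.2 ⟨_, rfl⟩)), hbt.add ?_⟩
      have hu : HasTop w ((homogenize w u).coeff (D - d)) (D - d)
          ((homogenize w u).coeff (D - d)) := by
        rw [HasTop, homogenize_coeff]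
        exact ⟨Polynomial.natDegree_C_mul_X_pow_le _ _, by simp⟩
      have := hu.mul hf
      rwa [Nat.sub_add_cancel hD, ← Polynomial.coeff_mul_C _ _ g] at this
    · exact ⟨b, Ideal.mem_sup_left hb, by simpa using hbt⟩

end WeightFiltration

open WeightFiltration RingTheory.Sequence

/-- A monomial coprime to a set of monomials is a nonzerodivisor modulo them. -/
lemma mem_span_monomial_of_mul_mem {σ R : Type*} [CommRing R] {S : Set (σ →₀ ℕ)} {t : σ →₀ ℕ}
    (ht : ∀ s ∈ S, Disjoint s.support t.support) {r : R} (hr : IsUnit r) {c : MvPolynomial σ R}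
    (hc : c * monomial t r ∈ Ideal.span ((fun s => monomial s (1 : R)) '' S)) :
    c ∈ Ideal.span ((fun s => monomial s (1 : R)) '' S) := by
  rw [mem_ideal_span_monomial_image] at hc ⊢
  intro x hx
  obtain ⟨s, hs, hsx⟩ := hc (x + t) (by
    rw [mem_support_iff] at hx ⊢
    rw [coeff_mul_monomial]
    rwa [Ne, hr.mul_left_eq_zero])
  refine ⟨s, hs, fun i => ?_⟩
  by_cases hi : s i = 0
  · simp [hi]
  · have hti : t i = 0 := by
      simpa using Finset.disjoint_left.1 (ht s hs) (Finsupp.mem_support_iff.2 hi)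
    simpa [hti] using hsx i

/-- A sequence of polynomials whose top-weight components are pairwise coprime monomials is
weakly regular. -/
theorem isWeaklyRegular_of_coprime_top {σ R ι : Type*} [CommRing R] (w : σ → ℕ)
    (f : ι → MvPolynomial σ R) (t : ι → σ →₀ ℕ) (r : ι → R) (d : ι → ℕ) (l : List ι)
    (hf : ∀ i ∈ l, HasTop w (f i) (d i) (monomial (t i) (r i))) (hr : ∀ i ∈ l, IsUnit (r i))
    (hl : l.Pairwise fun i j => Disjoint (t i).support (t j).support) :
    IsWeaklyRegular (MvPolynomial σ R) (l.map f) := by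
  suffices H : IsWeaklyRegular (MvPolynomial σ R) (l.map f) ∧
      IsTopIdeal w (Ideal.ofList (l.map f))
        (Ideal.span ((fun s => monomial s (1 : R)) '' (t '' {i | i ∈ l}))) from H.1
  induction l using List.reverseRecOn with
  | nil => simpa using isTopIdeal_bot
  | append_singleton l i ih =>
    rw [List.pairwise_append] at hl
    obtain ⟨ihr, iht⟩ := ih (fun j hj => hf j (by simp [hj])) (fun j hj => hr j (by simp [hj]))
      hl.1
    have hi := hf i (by simp)
    have hri := hr i (by simp)
    have hnz : ∀ c, c * monomial (t i) (r i) ∈ _ → c ∈ _ := fun c =>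
      mem_span_monomial_of_mul_mem (S := t '' {i | i ∈ l}) (t := t i) (by
        rintro _ ⟨j, hj, rfl⟩
        exact hl.2.2 j hj i (by simp)) hri
    rw [List.map_append, List.map_singleton]
    constructor
    · rw [isWeaklyRegular_append_iff, isWeaklyRegular_singleton_iff,
        isSMulRegular_quotient_iff_mem_of_smul_mem]
      refine ⟨ihr, fun a ha => ?_⟩
      rw [smul_eq_mul, Ideal.mul_top] at ha ⊢
      rw [smul_eq_mul, mul_comm] at ha
      exact iht.mem_of_mul_mem hi hnz ha
    · rw [Ideal.ofList_append, Ideal.ofList_singleton]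
      convert iht.sup_span hi hnz using 1
      have hset : {j | j ∈ l ++ [i]} = {j | j ∈ l} ∪ {i} := by
        ext
        simp [or_comm]
      rw [hset, Set.image_union, Set.image_union, Ideal.span_union, Set.image_singleton,
        Set.image_singleton]
      congr 1
      have : (monomial (t i) (r i) : MvPolynomial σ R) = C (r i) * monomial (t i) 1 := by
        rw [C_mul_monomial, mul_one]
      rw [this, Ideal.span_singleton_mul_left_unit (hri.map C)]

namespace IsotropicCoordinates

/-- Variables `u (k, i)`, `v (k, i)` and `z (s, i)` in isotropic coordinates. -/
abbrev Var (m r : ℕ) := ((Fin m ⊕ Fin m) ⊕ Fin r) × Fin m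

variable {m r : ℕ}

/-- The `u`-variables. -/
noncomputable abbrev u (k i : Fin m) : MvPolynomial (Var m r) ℂ := X (.inl (.inl k), i)

/-- The `v`-variables. -/
noncomputable abbrev v (k i : Fin m) : MvPolynomial (Var m r) ℂ := X (.inl (.inr k), i)

/-- The anisotropic variables. -/
noncomputable abbrev z (s : Fin r) (i : Fin m) : MvPolynomial (Var m r) ℂ := X (.inr s, i)

/-- The change of variables `x = u + v`, `y = I (u - v)`, turning `x ^ 2 + y ^ 2` into `4 u v`. -/
noncomputable def toIsotropic : MvPolynomial (Var m r) ℂ →ₐ[ℂ] MvPolynomial (Var m r) ℂ :=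
  aeval fun
    | (.inl (.inl k), i) => u k i + v k i
    | (.inl (.inr k), i) => C Complex.I * (u k i - v k i)
    | (.inr s, i) => z s i

/-- The inverse of `toIsotropic`. -/
noncomputable def ofIsotropic : MvPolynomial (Var m r) ℂ →ₐ[ℂ] MvPolynomial (Var m r) ℂ :=
  aeval fun
    | (.inl (.inl k), i) => C (1 / 2) * (u k i - C Complex.I * v k i)
    | (.inl (.inr k), i) => C (1 / 2) * (u k i + C Complex.I * v k i)
    | (.inr s, i) => z s i

lemma C_I_mul_C_I : (C Complex.I * C Complex.I : MvPolynomial (Var m r) ℂ) = -1 := by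
  rw [← C_mul, Complex.I_mul_I, C_neg, C_1]

lemma two_mul_C_half : (2 * C (1 / 2) : MvPolynomial (Var m r) ℂ) = 1 := by
  rw [show (2 : MvPolynomial (Var m r) ℂ) = C 2 from (map_ofNat C 2).symm, ← C_mul]
  norm_num

/-- The change of variables as an automorphism. -/
noncomputable def isotropicEquiv : MvPolynomial (Var m r) ℂ ≃ₐ[ℂ] MvPolynomial (Var m r) ℂ :=
  AlgEquiv.ofAlgHom toIsotropic ofIsotropic
    (by
      ext1 ⟨(k | k) | s, i⟩ <;>
        simp only [toIsotropic, ofIsotropic, AlgHom.comp_apply, aeval_X, map_mul, map_sub, map_add,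
          AlgHom.id_apply, MvPolynomial.algHom_C, MvPolynomial.algebraMap_eq]
      · linear_combination (u k i) * two_mul_C_half - C (1 / 2) * (u k i - v k i) * C_I_mul_C_I
      · linear_combination (v k i) * two_mul_C_half + C (1 / 2) * (u k i - v k i) * C_I_mul_C_I)
    (by
      ext1 ⟨(k | k) | s, i⟩ <;>
        simp only [toIsotropic, ofIsotropic, AlgHom.comp_apply, aeval_X, map_mul, map_sub, map_add,
          AlgHom.id_apply, MvPolynomial.algHom_C, MvPolynomial.algebraMap_eq]
      · linear_combination (u k i) * two_mul_C_half
      · linear_combination (-2 * C (1 / 2) * v k i) * C_I_mul_C_I + (v k i) * two_mul_C_half)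

/-- The quadrics in isotropic coordinates. -/
noncomputable def quadric (i j : Fin m) : MvPolynomial (Var m r) ℂ :=
  ∑ k, C 2 * (u k i * v k j + v k i * u k j) + ∑ s, z s i * z s j

/-- The isomorphism of `A` with the polynomial ring in isotropic coordinates. -/
noncomputable def coordinateEquiv (m r : ℕ) : A (m + m + r) m ≃ₐ[ℂ] MvPolynomial (Var m r) ℂ :=
  (renameEquiv ℂ (((finSumFinEquiv.sumCongr (Equiv.refl _)).trans finSumFinEquiv).symm.prodCongr
    (Equiv.refl _))).trans isotropicEquiv

lemma coordinateEquiv_fquad (i j : Fin m) :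
    coordinateEquiv m r (fquad (m + m + r) m i j) = quadric i j := by
  rw [fquad, map_sum, quadric,
    ← ((finSumFinEquiv.sumCongr (Equiv.refl _)).trans finSumFinEquiv).sum_comp,
    Fintype.sum_sum_type, Fintype.sum_sum_type, ← Finset.sum_add_distrib]
  congr 1
  · refine Finset.sum_congr rfl fun k _ => ?_
    simp only [coordinateEquiv, isotropicEquiv, toIsotropic, map_mul, AlgEquiv.trans_apply,
      renameEquiv_apply, rename_X, Equiv.prodCongr_apply, Prod.map, Equiv.symm_apply_apply,
      Equiv.refl_apply, AlgEquiv.ofAlgHom_apply, aeval_X]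
    rw [show (C 2 : MvPolynomial (Var m r) ℂ) = 2 from map_ofNat C 2]
    linear_combination (u k i - v k i) * (u k j - v k j) * C_I_mul_C_I
  · refine Finset.sum_congr rfl fun k _ => ?_
    simp only [coordinateEquiv, isotropicEquiv, toIsotropic, map_mul, AlgEquiv.trans_apply,
      renameEquiv_apply, rename_X, Equiv.prodCongr_apply, Prod.map, Equiv.symm_apply_apply,
      Equiv.refl_apply, AlgEquiv.ofAlgHom_apply, aeval_X]

/-- Weights for which `quadric i j` has top component a multiple of `u (j - i) i * v (j - i) j`. -/
def weight : Var m r → ℕ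
  | (.inl (.inl k), i) => 2 * m * m + 1 - 2 * k * i
  | (.inl (.inr k), i) => 2 * m * m + 1 + 2 * k * i - k * k
  | (.inr _, _) => 2 * m * m

lemma weight_u (k i : Fin m) :
    (weight (r := r) (.inl (.inl k), i) : ℤ) = 2 * m * m + 1 - 2 * k * i := by
  have : 2 * (k : ℕ) * i ≤ 2 * m * m + 1 := by nlinarith [k.2, i.2]
  rw [weight, Nat.cast_sub this]
  push_cast
  ring

lemma weight_v (k i : Fin m) :
    (weight (r := r) (.inl (.inr k), i) : ℤ) = 2 * m * m + 1 + 2 * k * i - k * k := by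
  have : (k : ℕ) * k ≤ 2 * m * m + 1 + 2 * k * i := by nlinarith [k.2, i.2]
  rw [weight, Nat.cast_sub this]
  push_cast
  ring

/-- The index of the pair of variables in the top component of `quadric i j`. -/
def shift (i j : Fin m) : Fin m := ⟨j - i, (Nat.sub_le _ _).trans_lt j.2⟩

/-- The exponent of the top component of `quadric i j`. -/
noncomputable def topExponent (i j : Fin m) : Var m r →₀ ℕ :=
  Finsupp.single (.inl (.inl (shift i j)), i) 1 + Finsupp.single (.inl (.inr (shift i j)), j) 1

lemma monomial_topExponent (i j : Fin m) (c : ℂ) :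
    monomial (topExponent (r := r) i j) c = C c * (u (shift i j) i * v (shift i j) j) := by
  rw [u, v, X, X, monomial_mul, C_mul_monomial, topExponent]
  simp

lemma hasTop_quadric {i j : Fin m} (hij : i ≤ j) :
    HasTop weight (quadric (r := r) i j) (2 * (2 * m * m + 1) + (j - i) * (j - i))
      (monomial (topExponent i j) (if i = j then 4 else 2)) := by
  obtain ⟨δ, hδ⟩ := Nat.exists_eq_add_of_le (Fin.le_def.1 hij)
  have hδ' : (j : ℕ) - i = δ := by omega
  have hδz : (j : ℤ) = i + δ := by exact_mod_cast hδ
  rw [monomial_topExponent, hδ', quadric, ← add_zero (C _ * _)]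
  refine HasTop.add ?_ ?_
  · have key : ∀ k : Fin m, HasTop (weight (r := r)) (C 2 * (u k i * v k j + v k i * u k j))
        (2 * (2 * m * m + 1) + δ * δ)
        (if k = shift i j then C (if i = j then 4 else 2) * (u k i * v k j) else 0) := by
      intro k
      have h1 := (hasTop_X (R := ℂ) (w := weight (r := r)) (.inl (.inl k), i)).mul
        (hasTop_X (R := ℂ) (w := weight (r := r)) (.inl (.inr k), j))
      have h2 := (hasTop_X (R := ℂ) (w := weight (r := r)) (.inl (.inr k), i)).mul
        (hasTop_X (R := ℂ) (w := weight (r := r)) (.inl (.inl k), j))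
      have hui := weight_u (r := r) k i
      have huj := weight_u (r := r) k j
      have hvi := weight_v (r := r) k i
      have hvj := weight_v (r := r) k j
      rw [hδz] at huj hvj
      by_cases hk : k = shift i j
      · have hkδ : (k : ℕ) = δ := by rw [hk, shift]; exact hδ'
        have hkz : (k : ℤ) = δ := by exact_mod_cast hkδ
        rw [hkz] at hui huj hvi hvj
        have e1 : weight (r := r) (.inl (.inl k), i) + weight (r := r) (.inl (.inr k), j) =
            2 * (2 * m * m + 1) + δ * δ := by
          zify; rw [hui, hvj]; ring
        rw [e1] at h1
        rw [if_pos hk]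
        by_cases hd : i = j
        · subst hd
          have h := (h1.add (by simpa only [mul_comm] using h1)).C_mul 2
          convert h using 1
          · rw [mul_comm (v k i)]
          · rw [if_pos rfl, show (C 4 : MvPolynomial (Var m r) ℂ) = C 2 * 2 by
              rw [show (2 : MvPolynomial (Var m r) ℂ) = C 2 from (map_ofNat C 2).symm, ← C_mul]
              norm_num]
            ring
        · have hpos : 0 < δ := by
            rcases Nat.eq_zero_or_pos δ with h0 | h0
            · exact absurd (Fin.ext (by omega)) hd
            · exact h0
          have h2' := h2.of_lt (e := 2 * (2 * m * m + 1) + δ * δ) (by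
            zify; rw [hvi, huj]; nlinarith [(by exact_mod_cast hpos : (0 : ℤ) < δ)])
          rw [if_neg hd]
          simpa using (h1.add h2').C_mul 2
      · have hkδ : (k : ℤ) ≠ δ := by
          intro h
          exact hk (Fin.ext (by rw [shift]; simp only; omega))
        have hsq : 0 < ((k : ℤ) - δ) ^ 2 := by
          have := sub_ne_zero.2 hkδ
          positivity
        have h1' := h1.of_lt (e := 2 * (2 * m * m + 1) + δ * δ) (by
          zify; rw [hui, hvj]; nlinarith)
        have h2' := h2.of_lt (e := 2 * (2 * m * m + 1) + δ * δ) (by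
          zify; rw [hvi, huj]
          nlinarith [mul_nonneg (Int.natCast_nonneg (k : ℕ)) (Int.natCast_nonneg δ)])
        rw [if_neg hk]
        simpa using (h1'.add h2').C_mul 2
    simpa using HasTop.sum Finset.univ fun k _ => key k
  · have key : ∀ s : Fin r, HasTop (weight (m := m)) (z s i * z s j)
        (2 * (2 * m * m + 1) + δ * δ) 0 := fun s =>
      ((hasTop_X _).mul (hasTop_X _)).of_lt (by
        simp only [weight]
        nlinarith)
    simpa using HasTop.sum Finset.univ fun s _ => key s

lemma mem_support_topExponent {i j : Fin m} {x : Var m r} :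
    x ∈ (topExponent i j).support ↔
      x = (.inl (.inl (shift i j)), i) ∨ x = (.inl (.inr (shift i j)), j) := by
  classical
  rw [topExponent, Finsupp.mem_support_iff, Finsupp.add_apply, Finsupp.single_apply,
    Finsupp.single_apply]
  grind

lemma disjoint_topExponent {i j i' j' : Fin m} (h : i ≤ j) (h' : i' ≤ j')
    (hne : (i, j) ≠ (i', j')) :
    Disjoint (topExponent (r := r) i j).support (topExponent (r := r) i' j').support := by
  rw [Finset.disjoint_left]
  intro x hx hx'
  rw [mem_support_topExponent] at hx hx'
  apply hne
  rw [Fin.le_def] at h h'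
  rcases hx with rfl | rfl <;> simp [shift] at hx' <;> ext <;> simp only <;> omega

/-- The pairs `i ≤ j` in lexicographic order. -/
def pairs (m : ℕ) : List (Fin m × Fin m) :=
  (List.finRange m).flatMap fun i => ((List.finRange m).filter fun j => i ≤ j).map fun j => (i, j)

lemma fst_le_snd_of_mem_pairs {p : Fin m × Fin m} (hp : p ∈ pairs m) : p.1 ≤ p.2 := by
  simp only [pairs, List.mem_flatMap, List.mem_map, List.mem_filter] at hp
  obtain ⟨i, -, j, ⟨-, hij⟩, rfl⟩ := hp
  simpa using hij

lemma nodup_pairs (m : ℕ) : (pairs m).Nodup := by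
  rw [pairs, List.nodup_flatMap]
  refine ⟨fun i _ => ((List.nodup_finRange m).filter _).map fun _ _ h => (Prod.ext_iff.1 h).2,
    (List.nodup_finRange m).imp fun hij p hp hq => hij ?_⟩
  simp only [List.mem_map] at hp hq
  obtain ⟨_, -, rfl⟩ := hp
  obtain ⟨_, -, hq⟩ := hq
  exact (Prod.ext_iff.1 hq).1.symm

lemma Fseq_eq_map (n m : ℕ) : Fseq n m = (pairs m).map fun p => fquad n m p.1 p.2 := by
  simp [Fseq, pairs, List.map_flatMap, Function.comp_def]

lemma isWeaklyRegular_quadric (m r : ℕ) :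
    IsWeaklyRegular (MvPolynomial (Var m r) ℂ)
      ((pairs m).map fun p => (quadric p.1 p.2 : MvPolynomial (Var m r) ℂ)) :=
  isWeaklyRegular_of_coprime_top weight _ (fun p => topExponent p.1 p.2)
    (fun p => if p.1 = p.2 then 4 else 2)
    (fun p => 2 * (2 * m * m + 1) + (p.2 - p.1) * (p.2 - p.1)) _
    (fun p hp => hasTop_quadric (fst_le_snd_of_mem_pairs hp))
    (fun p _ => by split_ifs <;> simp)
    ((nodup_pairs m).imp_of_mem fun {p q} hp hq (hpq : p ≠ q) => disjoint_topExponent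
      (fst_le_snd_of_mem_pairs hp) (fst_le_snd_of_mem_pairs hq) hpq)

lemma isRegular_Fseq (m r : ℕ) : IsRegular (A (m + m + r) m) (Fseq (m + m + r) m) where
  toIsWeaklyRegular := by
    refine ((coordinateEquiv m r).toAddEquiv.isWeaklyRegular_congr ?_).2
      (isWeaklyRegular_quadric m r)
    rw [Fseq_eq_map, List.forall₂_map_left_iff, List.forall₂_map_right_iff, List.forall₂_same]
    intro p _ x
    rw [← coordinateEquiv_fquad]
    exact map_mul (coordinateEquiv m r) _ _
  top_ne_smul h := by
    rw [smul_eq_mul, Ideal.mul_top] at h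
    have hle : Ideal.ofList (Fseq (m + m + r) m) ≤
        RingHom.ker (constantCoeff : A (m + m + r) m →+* ℂ) := by
      rw [Ideal.ofList, Ideal.span_le]
      intro f hf
      rw [Set.mem_ofPred_eq, Fseq_eq_map, List.mem_map] at hf
      obtain ⟨p, -, rfl⟩ := hf
      simp [fquad, RingHom.mem_ker]
    exact RingHom.ker_ne_top _ (top_le_iff.1 (h.le.trans hle))

end IsotropicCoordinates

theorem stmt2 (n : ℕ) (hn : 0 < n) :
    RingTheory.Sequence.IsRegular (A n (n / 2)) (Fseq n (n / 2)) := by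
  have h := IsotropicCoordinates.isRegular_Fseq (n / 2) (n % 2)
  rwa [show n / 2 + n / 2 + n % 2 = n by omega] at h
end

section
/- Let n and m ≥ 2 be positive integers. If the quadratic polynomials f_{n,i,j} with 1 ≤ i ≤ j ≤ m, listed in lexicographic order of (i,j), form a regular sequence in A_{n,m}, then the quadratic polynomials f_{n,i,j} with 1 ≤ i ≤ j ≤ m−1, listed in lexicographic order of (i,j), form a regular sequence in A_{n,m−1}. -/
open MvPolynomial

namespace MvPolynomial

section Homogeneous

variable {σ R : Type*} [CommRing R]

attribute [local instance] MvPolynomial.gradedAlgebra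

lemma homogeneousComponent_mul_of_isHomogeneous_left {k : ℕ} {a : MvPolynomial σ R}
    (ha : a.IsHomogeneous k) (g : MvPolynomial σ R) (n : ℕ) :
    homogeneousComponent n (a * g) =
      if k ≤ n then a * homogeneousComponent (n - k) g else 0 := by
  have h := DirectSum.coe_decompose_mul_of_left_mem (homogeneousSubmodule σ R) n (b := g)
    ((mem_homogeneousSubmodule k a).2 ha)
  have key (φ : MvPolynomial σ R) (i : ℕ) :
      (DirectSum.decompose (homogeneousSubmodule σ R) φ i : MvPolynomial σ R) =
        homogeneousComponent i φ := decomposition.decompose'_apply φ i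
  simpa only [key] using h

lemma homogeneousComponent_mem_ofList {rs : List (MvPolynomial σ R)}
    (hrs : ∀ r ∈ rs, ∃ k, r.IsHomogeneous k) {p : MvPolynomial σ R}
    (hp : p ∈ Ideal.ofList rs) (n : ℕ) : homogeneousComponent n p ∈ Ideal.ofList rs :=
  homogeneousComponent_mem_of_mem
    (Ideal.homogeneous_span _ _ fun r hr => (hrs r hr).imp fun _ h => h) hp n

/-- Graded Nakayama for the colon ideal `(rs : b)` modulo `rs`. -/
lemma mem_ofList_of_colon_le {rs : List (MvPolynomial σ R)} {a b : MvPolynomial σ R} {k : ℕ}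
    (hrs : ∀ r ∈ rs, ∃ k, r.IsHomogeneous k) (hk : 0 < k) (ha : a.IsHomogeneous k)
    (H : ∀ x, b * x ∈ Ideal.ofList rs →
      ∃ y, b * y ∈ Ideal.ofList rs ∧ x - a * y ∈ Ideal.ofList rs)
    {x : MvPolynomial σ R} (hx : b * x ∈ Ideal.ofList rs) : x ∈ Ideal.ofList rs := by
  suffices h : ∀ n x, b * x ∈ Ideal.ofList rs → homogeneousComponent n x ∈ Ideal.ofList rs by
    rw [← sum_homogeneousComponent x]
    exact sum_mem fun n _ => h n x hx
  intro n
  induction n using Nat.strong_induction_on with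
  | _ n ih =>
    intro x hx
    obtain ⟨y, hy, hxy⟩ := H x hx
    have h := homogeneousComponent_mem_ofList hrs hxy n
    rw [map_sub, homogeneousComponent_mul_of_isHomogeneous_left ha] at h
    split_ifs at h with hkn
    · exact (Submodule.sub_mem_iff_left _
        (Ideal.mul_mem_left _ _ (ih (n - k) (by omega) y hy))).1 h
    · simpa using h

end Homogeneous

end MvPolynomial

namespace RingTheory.Sequence

lemma isWeaklyRegular_self_iff {R : Type*} [CommRing R] {rs : List R} :
    IsWeaklyRegular R rs ↔ ∀ i (h : i < rs.length) (x : R),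
      rs[i] * x ∈ Ideal.ofList (rs.take i) → x ∈ Ideal.ofList (rs.take i) := by
  simp [isWeaklyRegular_iff, isSMulRegular_quotient_iff_mem_of_smul_mem]

/-- A weakly regular sequence of homogeneous polynomials of positive degree stays weakly
regular under permutation. -/
lemma IsWeaklyRegular.of_perm_of_isHomogeneous {σ R : Type*} [CommRing R]
    {rs rs' : List (MvPolynomial σ R)} (h : IsWeaklyRegular (MvPolynomial σ R) rs)
    (hp : rs.Perm rs') (hrs : ∀ r ∈ rs, ∃ k, 0 < k ∧ r.IsHomogeneous k) :
    IsWeaklyRegular (MvPolynomial σ R) rs' := by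
  refine h.prototype_perm hp fun a b ts hts hK => ?_
  set K := Submodule.torsionBy (MvPolynomial σ R)
    (MvPolynomial σ R ⧸ (Ideal.ofList ts • ⊤ :
      Submodule (MvPolynomial σ R) (MvPolynomial σ R))) b
  have hmem : ∀ r ∈ a :: b :: ts, ∃ k, 0 < k ∧ r.IsHomogeneous k :=
    fun r hr => hrs r (hts.subset hr)
  obtain ⟨k, hk, ha⟩ := hmem a (by simp)
  have hI : (Ideal.ofList ts • ⊤ : Submodule (MvPolynomial σ R) (MvPolynomial σ R)) =
      Ideal.ofList ts := by simp
  have hmk (x : MvPolynomial σ R) :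
      Submodule.Quotient.mk (p := Ideal.ofList ts • ⊤) x ∈ K ↔ b * x ∈ Ideal.ofList ts := by
    rw [Submodule.mem_torsionBy_iff, ← Submodule.Quotient.mk_smul,
      Submodule.Quotient.mk_eq_zero, hI, smul_eq_mul]
  rw [eq_bot_iff]
  intro q hq
  obtain ⟨x, rfl⟩ := Submodule.Quotient.mk_surjective _ q
  rw [Submodule.mem_bot, Submodule.Quotient.mk_eq_zero, hI]
  refine MvPolynomial.mem_ofList_of_colon_le
    (fun r hr => (hmem r (by simp [hr])).imp fun _ h => h.2) hk ha (fun z hz => ?_)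
    ((hmk x).1 hq)
  rw [← hmk, hK] at hz
  obtain ⟨w, hw, hwz⟩ := Submodule.mem_smul_pointwise_iff_exists _ _ _ |>.1 hz
  obtain ⟨y, rfl⟩ := Submodule.Quotient.mk_surjective _ w
  refine ⟨y, (hmk y).1 hw, ?_⟩
  rw [← Submodule.Quotient.mk_smul, eq_comm, Submodule.Quotient.eq, hI, smul_eq_mul] at hwz
  exact hwz

/-- Weak regularity descends along a ring homomorphism with a retraction. -/
lemma IsWeaklyRegular.of_map_of_leftInverse {R S : Type*} [CommRing R] [CommRing S]
    {φ : R →+* S} {ρ : S →+* R} (hρ : Function.LeftInverse ρ φ) {rs : List R}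
    (h : IsWeaklyRegular S (rs.map φ)) : IsWeaklyRegular R rs := by
  rw [isWeaklyRegular_self_iff] at h ⊢
  intro i hi x hx
  have hmap : Ideal.ofList ((rs.map φ).take i) = (Ideal.ofList (rs.take i)).map φ := by
    rw [Ideal.map_ofList, List.map_take]
  have := h i (by simpa using hi) (φ x) (by
    rw [List.getElem_map, ← map_mul, hmap]
    exact Ideal.mem_map_of_mem φ hx)
  rw [hmap] at this
  have := Ideal.mem_map_of_mem ρ this
  rwa [Ideal.map_map, hρ x, show ρ.comp φ = RingHom.id R from RingHom.ext hρ,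
    Ideal.map_id] at this

end RingTheory.Sequence

lemma exists_eq_fquad_of_mem_Fseq {n m : ℕ} {r : A n m} (hr : r ∈ Fseq n m) :
    ∃ i j, r = fquad n m i j := by
  simp only [Fseq, List.mem_flatMap, List.mem_map] at hr
  obtain ⟨i, -, j, -, rfl⟩ := hr
  exact ⟨i, j, rfl⟩

lemma isHomogeneous_fquad (n m : ℕ) (i j : Fin m) : (fquad n m i j).IsHomogeneous 2 :=
  IsHomogeneous.sum _ _ _ fun s _ => (isHomogeneous_X ℂ (s, i)).mul (isHomogeneous_X ℂ (s, j))

/-- The inclusion `A_{n,m} → A_{n,m+1}`. -/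
noncomputable def inclA (n m : ℕ) : A n m →+* A n (m + 1) :=
  (rename (Prod.map id Fin.castSucc)).toRingHom

lemma inclA_fquad (n m : ℕ) (i j : Fin m) :
    inclA n m (fquad n m i j) = fquad n (m + 1) i.castSucc j.castSucc := by
  simp [inclA, fquad]

lemma map_inclA_Fseq_sublist (n m : ℕ) :
    ((Fseq n m).map (inclA n m)).Sublist (Fseq n (m + 1)) := by
  rw [Fseq, Fseq, List.map_flatMap, List.finRange_succ_last, List.flatMap_append,
    List.flatMap_map]
  refine .trans (List.Sublist.flatMap_right _ fun i _ => ?_) (List.sublist_append_left _ _)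
  rw [List.filter_append, List.map_append, List.filter_map, List.map_map, List.map_map]
  convert! List.sublist_append_left _ _ using 2
  simp [Function.comp_def, inclA_fquad]

lemma exists_leftInverse_inclA (n m : ℕ) :
    ∃ ρ : A n (m + 1) →+* A n m, Function.LeftInverse ρ (inclA n m) :=
  ⟨(killCompl (Function.injective_id.prodMap (Fin.castSucc_injective m))).toRingHom,
    killCompl_rename_app _⟩

lemma ofList_Fseq_ne_top (n m : ℕ) : Ideal.ofList (Fseq n m) ≠ ⊤ := by
  have hle : Ideal.ofList (Fseq n m) ≤ RingHom.ker (constantCoeff (R := ℂ)) := by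
    refine Ideal.span_le.2 fun r hr => ?_
    obtain ⟨i, j, rfl⟩ := exists_eq_fquad_of_mem_Fseq hr
    simp [RingHom.mem_ker, fquad]
  exact fun h => RingHom.ker_ne_top _ (top_le_iff.1 (h ▸ hle))

theorem stmt3 (n m : ℕ) (hn : 0 < n) (hm : 2 ≤ m)
    (h : RingTheory.Sequence.IsRegular (A n m) (Fseq n m)) :
    RingTheory.Sequence.IsRegular (A n (m - 1)) (Fseq n (m - 1)) := by
  obtain ⟨m, rfl⟩ : ∃ k, m = k + 1 := ⟨m - 1, by omega⟩
  rw [Nat.add_sub_cancel]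
  refine ⟨?_, by simpa using (ofList_Fseq_ne_top n m).symm⟩
  obtain ⟨l, hl⟩ := (map_inclA_Fseq_sublist n m).exists_perm_append
  obtain ⟨ρ, hρ⟩ := exists_leftInverse_inclA n m
  have hperm := h.toIsWeaklyRegular.of_perm_of_isHomogeneous hl fun r hr => by
    obtain ⟨i, j, rfl⟩ := exists_eq_fquad_of_mem_Fseq hr
    exact ⟨2, two_pos, isHomogeneous_fquad n (m + 1) i j⟩
  exact .of_map_of_leftInverse hρ
    ((RingTheory.Sequence.isWeaklyRegular_append_iff _ _ _).1 hperm).1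
end

section
/- Let N and k be positive integers and work in the polynomial ring A_{2N,k}. For any scalars α_{i,j} ∈ ℂ (1 ≤ i ≤ j ≤ k), not all zero, the quadric Q = Σ_{1 ≤ i ≤ j ≤ k} α_{i,j} f_{2N,i,j} has strength at least N − 1; that is, Q cannot be written as Σ_{l=1}^{N−1} G_l H_l with each G_l, H_l ∈ A_{2N,k} homogeneous of positive degree. -/
open MvPolynomial

/-- The second-order partial derivatives at the origin of a product of two variables. -/
lemma constantCoeff_pderiv_pderiv_X_mul_X {σ : Type*} [DecidableEq σ] (a b c d : σ) :
    constantCoeff (pderiv a (pderiv b (X c * X d : MvPolynomial σ ℂ))) =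
      (if c = b then 1 else 0) * (if d = a then 1 else 0) +
        (if d = b then 1 else 0) * (if c = a then 1 else 0) := by
  simp only [Derivation.leibniz, pderiv_X, smul_eq_mul, map_add, map_mul, Pi.single_apply]
  split_ifs <;> simp_all

/-- The second-order partial derivatives at the origin of a product of two polynomials that vanish
at the origin. -/
lemma constantCoeff_pderiv_pderiv_mul {σ : Type*} (a b : σ) (p q : MvPolynomial σ ℂ)
    (hp : constantCoeff p = 0) (hq : constantCoeff q = 0) :
    constantCoeff (pderiv a (pderiv b (p * q))) =
      constantCoeff (pderiv b p) * constantCoeff (pderiv a q) +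
        constantCoeff (pderiv b q) * constantCoeff (pderiv a p) := by
  simp only [Derivation.leibniz, smul_eq_mul, map_add, map_mul, hp, hq]
  ring

lemma constantCoeff_eq_zero_of_isHomogeneous {σ : Type*} {p : MvPolynomial σ ℂ} {d : ℕ}
    (hd : 0 < d) (hp : p.IsHomogeneous d) : constantCoeff p = 0 := by
  rw [constantCoeff_eq]
  exact hp.coeff_eq_zero (by simpa using hd.ne)

/-- The Hessian of `fquad n m i j` at the origin. -/
lemma constantCoeff_pderiv_pderiv_fquad (n m : ℕ) (i j u v : Fin m) (s t : Fin n) :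
    constantCoeff (pderiv (t, u) (pderiv (s, v) (fquad n m i j))) =
      if s = t then (if i = v ∧ j = u then 1 else 0) + (if j = v ∧ i = u then 1 else 0)
      else 0 := by
  simp only [fquad, map_sum, constantCoeff_pderiv_pderiv_X_mul_X, Prod.mk.injEq]
  rw [Finset.sum_eq_single s]
  · split_ifs <;> simp_all
  · intro r _ hr
    simp [hr]
  · simp

/-- A homogeneous system with more unknowns than equations has a nontrivial solution. -/
lemma exists_ne_zero_forall_sum_mul_eq_zero {ι κ : Type*} [Fintype ι] [Fintype κ]
    (h : Fintype.card κ < Fintype.card ι) (c : κ → ι → ℂ) :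
    ∃ v : ι → ℂ, v ≠ 0 ∧ ∀ l, ∑ s, v s * c l s = 0 := by
  have hker : LinearMap.ker (Matrix.mulVecLin (Matrix.of c)) ≠ ⊥ :=
    LinearMap.ker_ne_bot_of_finrank_lt (by simpa using h)
  obtain ⟨v, hv, hv0⟩ := Submodule.exists_mem_ne_zero_of_ne_bot hker
  refine ⟨v, hv0, fun l => ?_⟩
  have := congrFun (LinearMap.mem_ker.1 hv) l
  simpa [Matrix.mulVec, dotProduct, mul_comm] using this

theorem stmt5 (N k : ℕ) (hN : 0 < N) (hk : 0 < k)
    (α : Fin k → Fin k → ℂ) (hα : ∃ i j : Fin k, i ≤ j ∧ α i j ≠ 0) :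
    ¬ ∃ G H : Fin (N - 1) → A (2 * N) k,
        (∀ l, ∃ d : ℕ, 0 < d ∧ (G l).IsHomogeneous d) ∧
        (∀ l, ∃ d : ℕ, 0 < d ∧ (H l).IsHomogeneous d) ∧
        (∑ p ∈ Finset.univ.filter (fun p : Fin k × Fin k => p.1 ≤ p.2),
            α p.1 p.2 • fquad (2 * N) k p.1 p.2) = ∑ l, G l * H l := by
  rintro ⟨G, H, hG, hH, hQ⟩
  obtain ⟨i, j, hij, hne⟩ := hα
  have hG0 (l) : constantCoeff (G l) = 0 := by
    obtain ⟨d, hd, h⟩ := hG l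
    exact constantCoeff_eq_zero_of_isHomogeneous hd h
  have hH0 (l) : constantCoeff (H l) = 0 := by
    obtain ⟨d, hd, h⟩ := hH l
    exact constantCoeff_eq_zero_of_isHomogeneous hd h
  obtain ⟨v, hv0, hv⟩ := exists_ne_zero_forall_sum_mul_eq_zero
    (ι := Fin (2 * N)) (κ := Fin (N - 1) ⊕ Fin (N - 1)) (by simp; omega)
    (Sum.elim (fun l s => constantCoeff (pderiv (s, j) (G l)))
      (fun l s => constantCoeff (pderiv (s, j) (H l))))
  obtain ⟨t, ht⟩ := Function.ne_iff.1 hv0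
  have hess (s : Fin (2 * N)) :
      (if s = t then α i j * (1 + if i = j then 1 else 0) else 0) =
        ∑ l, (constantCoeff (pderiv (s, j) (G l)) * constantCoeff (pderiv (t, i) (H l)) +
          constantCoeff (pderiv (s, j) (H l)) * constantCoeff (pderiv (t, i) (G l))) := by
    have h := congrArg (fun p => constantCoeff (pderiv (t, i) (pderiv (s, j) p))) hQ
    simp only [map_sum, Derivation.map_smul, constantCoeff_smul,
      constantCoeff_pderiv_pderiv_fquad,
      constantCoeff_pderiv_pderiv_mul _ _ _ _ (hG0 _) (hH0 _)] at h
    rw [← h, Finset.sum_eq_single (i, j)]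
    · by_cases hst : s = t <;> by_cases h' : i = j <;> simp [hst, h', eq_comm]
    · rintro ⟨a, b⟩ hab hne'
      have hab' : a ≤ b := by simpa using hab
      have h1 : ¬ (b = j ∧ a = i) := fun h => hne' (by rw [h.1, h.2])
      have h2 : ¬ (a = j ∧ b = i) := by
        rintro ⟨rfl, rfl⟩
        exact hne' (by rw [le_antisymm hab' hij])
      simp [h1, h2]
    · simp [hij]
  have hsum : ∑ s, v s * (if s = t then α i j * (1 + if i = j then 1 else 0) else 0) = 0 := by
    simp only [hess, Finset.mul_sum]
    rw [Finset.sum_comm]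
    refine Finset.sum_eq_zero fun l _ => ?_
    have h1 := hv (Sum.inl l)
    have h2 := hv (Sum.inr l)
    simp only [Sum.elim_inl, Sum.elim_inr] at h1 h2
    simp only [mul_add, ← mul_assoc, Finset.sum_add_distrib, ← Finset.sum_mul, h1, h2]
    simp
  have hc : (1 + if i = j then 1 else 0 : ℂ) ≠ 0 := by
    split_ifs <;> norm_num
  simp only [mul_ite, mul_zero, Finset.sum_ite_eq', Finset.mem_univ, if_true] at hsum
  exact mul_ne_zero ht (mul_ne_zero hne hc) (by simpa using hsum)
end

section
/- For every positive integer r there exists a positive integer N = N(r) with the following property: for every positive integer n and every collection Q_1, …, Q_r of homogeneous degree-2 polynomials in ℂ[x_1, …, x_n] whose collective strength is at least N, the sequence Q_1, …, Q_r is a regular sequence in ℂ[x_1, …, x_n]. -/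
open MvPolynomial

/-- `f` is a sum of `c` products of two homogeneous polynomials of positive degree. -/
def IsSumOfProducts {σ : Type*} (c : ℕ) (f : MvPolynomial σ ℂ) : Prop :=
  ∃ G H : Fin c → MvPolynomial σ ℂ,
    (∀ l, ∃ d : ℕ, 0 < d ∧ (G l).IsHomogeneous d) ∧
    (∀ l, ∃ d : ℕ, 0 < d ∧ (H l).IsHomogeneous d) ∧
    f = ∑ l, G l * H l

section Graded

attribute [local instance] MvPolynomial.gradedAlgebra

lemma homogeneousComponent_add_mul {σ S : Type*} [CommRing S] {φ : MvPolynomial σ S} {m : ℕ}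
    (hφ : φ.IsHomogeneous m) (d : ℕ) (f : MvPolynomial σ S) :
    homogeneousComponent (m + d) (φ * f) = φ * homogeneousComponent d f := by
  have := DirectSum.coe_decompose_mul_add_of_left_mem (homogeneousSubmodule σ S)
    (a := φ) (b := f) (i := m) (j := d) hφ
  rw [← decomposition.decompose'_apply, ← decomposition.decompose'_apply]
  exact this

/-- Swapping two elements of a homogeneous regular sequence, one of which is a variable. -/
lemma regular_swap {σ S : Type*} [CommRing S] {I : Ideal (MvPolynomial σ S)}
    (hI : I.IsHomogeneous (homogeneousSubmodule σ S)) (i : σ) {q : MvPolynomial σ S} {m : ℕ}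
    (hq : q.IsHomogeneous m) (hz : ∀ f, X i * f ∈ I → f ∈ I)
    (hqz : ∀ f, q * f ∈ I ⊔ Ideal.span {X i} → f ∈ I ⊔ Ideal.span {X i}) :
    (∀ f, q * f ∈ I → f ∈ I) ∧
      ∀ f, X i * f ∈ I ⊔ Ideal.span {q} → f ∈ I ⊔ Ideal.span {q} := by
  have key : ∀ f, q * f ∈ I → ∃ g, f - X i * g ∈ I ∧ q * g ∈ I := by
    intro f hf
    obtain ⟨a, ha, b, hb, hab⟩ := Submodule.mem_sup.mp
      (hqz f (Ideal.mem_sup_left hf))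
    obtain ⟨g, rfl⟩ := Ideal.mem_span_singleton'.mp hb
    have h1 : f - X i * g = a := by rw [← hab]; ring
    refine ⟨g, h1 ▸ ha, hz _ ?_⟩
    have : X i * (q * g) = q * f - q * a := by rw [← hab]; ring
    rw [this]
    exact I.sub_mem hf (I.mul_mem_left _ ha)
  have hom : ∀ d f, f.IsHomogeneous d → q * f ∈ I → f ∈ I := by
    intro d
    induction d with
    | zero =>
      intro f hf hqf
      obtain ⟨g, hg, -⟩ := key f hqf
      have := homogeneousComponent_mem_of_mem hI hg 0
      rw [map_sub, homogeneousComponent_eq_self hf] at this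
      simpa [homogeneousComponent_zero, ← constantCoeff_eq] using this
    | succ d ih =>
      intro f hf hqf
      obtain ⟨g, hg, hqg⟩ := key f hqf
      have h1 := homogeneousComponent_mem_of_mem hI hg (1 + d)
      rw [map_sub, homogeneousComponent_eq_self (by rwa [add_comm] : f.IsHomogeneous (1 + d)),
        homogeneousComponent_add_mul (isHomogeneous_X _ _)] at h1
      have h2 := homogeneousComponent_mem_of_mem hI hqg (m + d)
      rw [homogeneousComponent_add_mul hq] at h2
      have h3 := ih _ (homogeneousComponent_isHomogeneous d g) h2
      simpa using I.add_mem h1 (I.mul_mem_left (X i) h3)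
  have hreg : ∀ f, q * f ∈ I → f ∈ I := by
    intro f hf
    rw [mem_iff_homogeneousComponent_mem hI]
    intro d
    refine hom d _ (homogeneousComponent_isHomogeneous d f) ?_
    rw [← homogeneousComponent_add_mul hq]
    exact homogeneousComponent_mem_of_mem hI hf _
  refine ⟨hreg, fun f hf => ?_⟩
  obtain ⟨a, ha, b, hb, hab⟩ := Submodule.mem_sup.mp hf
  obtain ⟨g, rfl⟩ := Ideal.mem_span_singleton'.mp hb
  have hg : q * g ∈ I ⊔ Ideal.span {X i} := by
    have : q * g = -a + f * X i := by linear_combination hab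
    rw [this]
    exact add_mem (Ideal.mem_sup_left (I.neg_mem ha))
      (Ideal.mem_sup_right (Ideal.mul_mem_left _ _ (Ideal.mem_span_singleton_self _)))
  obtain ⟨a', ha', b', hb', hab'⟩ := Submodule.mem_sup.mp (hqz g hg)
  obtain ⟨h, rfl⟩ := Ideal.mem_span_singleton'.mp hb'
  have h1 : f - q * h ∈ I := by
    refine hz _ ?_
    have : X i * (f - q * h) = a + q * a' := by
      rw [mul_sub, ← hab, ← hab']; ring
    rw [this]
    exact I.add_mem ha (I.mul_mem_left _ ha')
  have : f = (f - q * h) + h * q := by ring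
  rw [this]
  exact add_mem (Ideal.mem_sup_left h1)
    (Ideal.mem_sup_right (Ideal.mul_mem_left _ _ (Ideal.mem_span_singleton_self _)))

lemma mem_span_monomial_of_X_pow_mul_mem {σ S : Type*} [CommRing S] {s : Set (σ →₀ ℕ)} {i : σ}
    (hs : ∀ e ∈ s, e i = 0) (m : ℕ) {f : MvPolynomial σ S}
    (hf : X i ^ m * f ∈ Ideal.span ((fun e => monomial e (1 : S)) '' s)) :
    f ∈ Ideal.span ((fun e => monomial e (1 : S)) '' s) := by
  rw [mem_ideal_span_monomial_image] at hf ⊢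
  intro d hd
  have h : Finsupp.single i m + d ∈ (X i ^ m * f).support := by
    rw [mem_support_iff, X_pow_eq_monomial, coeff_monomial_mul, one_mul]
    exact mem_support_iff.mp hd
  obtain ⟨e, he, hle⟩ := hf _ h
  refine ⟨e, he, fun j => ?_⟩
  by_cases hj : j = i
  · subst hj; simp [hs e he]
  · have := hle j
    simpa [Finsupp.single_apply, Ne.symm hj] using this

lemma regular_of_sub_X_sq_mem {S : Type*} [CommRing S] {r : ℕ}
    {q : Fin r → MvPolynomial (Option (Fin r)) S} (hq : ∀ i, (q i).IsHomogeneous 2)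
    (hmod : ∀ i, q i - X (some i) ^ 2 ∈ Ideal.span {X none}) (k : Fin r)
    {f : MvPolynomial (Option (Fin r)) S} (hf : q k * f ∈ Ideal.span (q '' {j | j < k})) :
    f ∈ Ideal.span (q '' {j | j < k}) := by
  let I : ℕ → Ideal (MvPolynomial (Option (Fin r)) S) := fun k => Ideal.span (q '' {j | j.val < k})
  have hI : ∀ k, (I k).IsHomogeneous (homogeneousSubmodule _ S) := by
    intro k
    refine Ideal.homogeneous_span _ _ ?_
    rintro _ ⟨j, -, rfl⟩
    exact ⟨2, hq j⟩
  have hsucc : ∀ k : Fin r, I (k + 1) = I k ⊔ Ideal.span {q k} := by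
    intro k
    simp only [I, ← Ideal.span_union]
    congr 1
    rw [← Set.image_singleton, ← Set.image_union]
    congr 1
    ext j
    simp [← Fin.ext_iff, le_iff_eq_or_lt]
  have hX : ∀ k, I k ⊔ Ideal.span {X none} = Ideal.span ((fun e => monomial e (1 : S)) ''
      (insert (Finsupp.single none 1)
        ((fun j => Finsupp.single (some j) 2) '' {j : Fin r | j.val < k}))) := by
    intro k
    rw [Set.image_insert_eq, Set.image_image, Ideal.span_insert]
    simp only [← X_pow_eq_monomial, pow_one, I]
    rw [sup_comm]
    refine le_antisymm (sup_le le_sup_left ?_) (sup_le le_sup_left ?_) <;>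
    · rw [Ideal.span_le]
      rintro _ ⟨j, hj, rfl⟩
      first
      | have h2 : q j = (q j - X (some j) ^ 2) + X (some j) ^ 2 := by ring
        rw [SetLike.mem_coe, h2]
        exact add_mem (Ideal.mem_sup_left (hmod j))
          (Ideal.mem_sup_right (Ideal.subset_span ⟨j, hj, rfl⟩))
      | have h2 : (X (some j) ^ 2 : MvPolynomial (Option (Fin r)) S)
            = - (q j - X (some j) ^ 2) + q j := by ring
        rw [SetLike.mem_coe]
        beta_reduce
        rw [h2]
        exact add_mem (Ideal.mem_sup_left (neg_mem (hmod j)))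
          (Ideal.mem_sup_right (Ideal.subset_span ⟨j, hj, rfl⟩))
  have hqX : ∀ k : Fin r, ∀ f, q k * f ∈ I k ⊔ Ideal.span {X none} →
      f ∈ I k ⊔ Ideal.span {X none} := by
    intro k f hf
    have h1 : X (some k) ^ 2 * f ∈ I k ⊔ Ideal.span {X none} := by
      have : X (some k) ^ 2 * f = q k * f - (q k - X (some k) ^ 2) * f := by ring
      rw [this]
      exact sub_mem hf (Ideal.mem_sup_right (Ideal.mul_mem_right _ _ (hmod k)))
    rw [hX] at h1 ⊢
    refine mem_span_monomial_of_X_pow_mul_mem ?_ 2 h1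
    rintro e (rfl | ⟨j, hj, rfl⟩)
    · simp
    · have : j ≠ k := fun h => by simp [h] at hj
      simp [this]
  have hz : ∀ k, k ≤ r → ∀ f, X none * f ∈ I k → f ∈ I k := by
    intro k
    induction k with
    | zero =>
      intro _ f hf
      simpa [I] using hf
    | succ k ih =>
      intro hk
      have := (regular_swap (hI k) none (hq ⟨k, hk⟩) (ih (by omega)) (hqX ⟨k, hk⟩)).2
      rwa [← hsucc ⟨k, hk⟩] at this
  exact (regular_swap (hI k) none (hq k) (hz k k.2.le) (hqX k)).1 f hf

end Graded
/-- A quadratic form over `ℂ` is given by a symmetric matrix. -/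
lemma exists_symmetric_matrix_of_isHomogeneous_two {n : ℕ} {f : MvPolynomial (Fin n) ℂ}
    (hf : f.IsHomogeneous 2) :
    ∃ M : Matrix (Fin n) (Fin n) ℂ, M.IsSymm ∧ f = ∑ a, ∑ b, C (M a b) * (X a * X b) := by
  suffices h : ∃ M : Matrix (Fin n) (Fin n) ℂ, f = ∑ a, ∑ b, C (M a b) * (X a * X b) by
    obtain ⟨M, hM⟩ := h
    have hT : f = ∑ a, ∑ b, C (M b a) * (X a * X b) := by
      rw [hM, Finset.sum_comm]
      exact Finset.sum_congr rfl fun a _ => Finset.sum_congr rfl fun b _ => by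
        rw [mul_comm (X b)]
    refine ⟨(1 / 2 : ℂ) • (M + M.transpose), ?_, ?_⟩
    · exact Matrix.IsSymm.ext fun a b => by simp [add_comm]
    · have h2 : f = C (1 / 2 : ℂ) * (f + f) := by
        rw [← two_mul, show (2 : MvPolynomial (Fin n) ℂ) = C 2 from (map_ofNat C 2).symm,
          ← mul_assoc, ← C_mul]
        norm_num
      conv_lhs => rw [h2]
      nth_rewrite 1 [hM]
      rw [hT, ← Finset.sum_add_distrib, Finset.mul_sum]
      refine Finset.sum_congr rfl fun a _ => ?_
      rw [← Finset.sum_add_distrib, Finset.mul_sum]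
      refine Finset.sum_congr rfl fun b _ => ?_
      simp only [Matrix.smul_apply, Matrix.add_apply, Matrix.transpose_apply, smul_eq_mul, C_mul,
        C_add]
      ring
  have hlin : ∀ g : MvPolynomial (Fin n) ℂ, g ∈ homogeneousSubmodule (Fin n) ℂ 1 →
      ∃ u : Fin n → ℂ, g = ∑ a, C (u a) * X a := by
    intro g hg
    rw [homogeneousSubmodule_one_eq_span_X, Submodule.mem_span_range_iff_exists_fun] at hg
    obtain ⟨u, rfl⟩ := hg
    exact ⟨u, by simp [smul_eq_C_mul]⟩
  rw [← mem_homogeneousSubmodule, ← homogeneousSubmodule_one_pow, pow_two] at hf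
  induction hf using Submodule.mul_induction_on' with
  | mem_mul_mem g hg h hh =>
    obtain ⟨u, rfl⟩ := hlin g hg
    obtain ⟨v, rfl⟩ := hlin h hh
    refine ⟨Matrix.of fun a b => u a * v b, ?_⟩
    rw [Finset.sum_mul_sum]
    refine Finset.sum_congr rfl fun a _ => Finset.sum_congr rfl fun b _ => ?_
    simp only [Matrix.of_apply, C_mul]
    ring
  | add g _ h _ ihg ihh =>
    obtain ⟨M, rfl⟩ := ihg
    obtain ⟨M', rfl⟩ := ihh
    exact ⟨M + M', by simp [add_mul, Finset.sum_add_distrib]⟩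

lemma exists_linear_polynomial {n : ℕ} (ℓ : (Fin n → ℂ) →ₗ[ℂ] ℂ) :
    ∃ p : MvPolynomial (Fin n) ℂ, p.IsHomogeneous 1 ∧ ∀ x, eval x p = ℓ x := by
  refine ⟨∑ a, C (ℓ (Pi.single a 1)) * X a, IsHomogeneous.sum _ _ _ fun a _ =>
    isHomogeneous_C_mul_X _ _, fun x => ?_⟩
  rw [LinearMap.pi_apply_eq_sum_univ ℓ x]
  simp only [map_sum, map_mul, eval_C, eval_X, smul_eq_mul]
  refine Finset.sum_congr rfl fun a _ => ?_
  rw [mul_comm]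
  congr 2
  ext j
  simp [Pi.single_apply, eq_comm]

/-- A quadratic form vanishing on a subspace of codimension at most `N` is a sum of `N` products. -/
lemma isSumOfProducts_of_forall_eval_eq_zero {n N : ℕ} {ι : Type*} [Fintype ι]
    (hι : Fintype.card ι ≤ N) {f : MvPolynomial (Fin n) ℂ}
    (B : LinearMap.BilinForm ℂ (Fin n → ℂ)) (hB : ∀ x y, B x y = B y x)
    (hf : ∀ x, eval x f = B x x) (ℓ : ι → (Fin n → ℂ) →ₗ[ℂ] ℂ)
    (h0 : ∀ x, (∀ k, ℓ k x = 0) → B x x = 0) : IsSumOfProducts N f := by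
  classical
  let L := LinearMap.pi ℓ
  obtain ⟨s, hs⟩ := L.rangeRestrict.exists_rightInverse_of_surjective
    (LinearMap.range_eq_top.mpr L.surjective_rangeRestrict)
  obtain ⟨g, hg⟩ := s.exists_extend
  have hLg : ∀ x, L (g (L x)) = L x := by
    intro x
    have h1 := LinearMap.congr_fun hg (L.rangeRestrict x)
    have h2 := congrArg Subtype.val (LinearMap.congr_fun hs (L.rangeRestrict x))
    simp only [LinearMap.comp_apply, Submodule.subtype_apply, LinearMap.id_apply,
      LinearMap.codRestrict_apply] at h1 h2
    change g (L x) = _ at h1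
    change L _ = L x at h2
    rw [h1, h2]
  let P : (Fin n → ℂ) →ₗ[ℂ] (Fin n → ℂ) := LinearMap.id - g ∘ₗ L
  have hP : ∀ x, B (P x) (P x) = 0 := by
    intro x
    refine h0 _ fun k => ?_
    have : L (P x) = 0 := by simp [P, hLg]
    exact congrFun this k
  have hgL : ∀ x, g (L x) = ∑ k, ℓ k x • g (Pi.single k 1) := by
    intro x
    rw [LinearMap.pi_apply_eq_sum_univ g (L x)]
    refine Finset.sum_congr rfl fun k _ => ?_
    congr 2
    ext j
    simp [Pi.single_apply, eq_comm]
  have hsum : ∀ x, B x x = ∑ k, ℓ k x * B (g (Pi.single k 1)) (x + P x) := by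
    intro x
    have h1 : B (g (L x)) (x + P x) = B x x := by
      have : g (L x) = x - P x := by simp [P]
      rw [this]
      simp [hP, hB (P x) x]
    rw [← h1, hgL]
    simp
  choose G hG hGe using fun k => exists_linear_polynomial (ℓ k)
  choose H hH hHe using fun k =>
    exists_linear_polynomial (B (g (Pi.single k 1)) ∘ₗ (LinearMap.id + P))
  obtain ⟨e⟩ : Nonempty (ι ↪ Fin N) := by
    rw [Function.Embedding.nonempty_iff_card_le]; simpa
  refine ⟨fun l => if h : ∃ k, e k = l then G h.choose else 0,
    fun l => if h : ∃ k, e k = l then H h.choose else 0, fun l => ⟨1, one_pos, ?_⟩,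
    fun l => ⟨1, one_pos, ?_⟩, ?_⟩
  · dsimp only; split_ifs
    exacts [hG _, isHomogeneous_zero _ _ _]
  · dsimp only; split_ifs
    exacts [hH _, isHomogeneous_zero _ _ _]
  · have hsplit : f = ∑ k, G k * H k := by
      refine MvPolynomial.funext fun x => ?_
      rw [hf, hsum]
      simp [hGe, hHe]
    rw [hsplit]
    refine Finset.sum_of_injOn e e.injective.injOn (by simp) ?_ ?_
    · intro l _ hl
      have : ¬ ∃ k, e k = l := fun ⟨k, hk⟩ => hl ⟨k, by simp, hk⟩
      simp [this]
    · intro k _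
      have h : ∃ k', e k' = e k := ⟨k, rfl⟩
      beta_reduce
      rw [dif_pos h, dif_pos h, e.injective h.choose_spec]

/-- Symmetric bilinear forms such that no nontrivial linear combination is isotropic on a subspace
of codimension at most `N`. -/
def IsAnisotropicFamily {r : ℕ} {V : Type*} [AddCommGroup V] [Module ℂ V] (N : ℕ)
    (B : Fin r → LinearMap.BilinForm ℂ V) : Prop :=
  ∀ c : Fin r → ℂ, c ≠ 0 → ∀ F : Finset V, r * F.card ≤ N →
    ∃ v, (∀ u ∈ F, ∀ i, B i u v = 0) ∧ ∑ i, c i * B i v v ≠ 0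

lemma IsAnisotropicFamily.exists_apply_eq {r : ℕ} {V : Type*} [AddCommGroup V] [Module ℂ V] {N : ℕ}
    {B : Fin r → LinearMap.BilinForm ℂ V} (hB : ∀ i x y, B i x y = B i y x)
    (h : IsAnisotropicFamily N B) (F : Finset V) (hF : r * (F.card + r) ≤ N) (t : Fin r → ℂ) :
    ∃ v, (∀ u ∈ F, ∀ i, B i u v = 0) ∧ ∀ i, B i v v = t i := by
  classical
  have key : ∀ j ≤ r, ∃ (E : Submodule ℂ (Fin r → ℂ)) (G : Finset V), G.card ≤ j ∧
      j ≤ Module.finrank ℂ E ∧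
      ∀ t ∈ E, ∃ v ∈ Submodule.span ℂ (G : Set V), (∀ u ∈ F, ∀ i, B i u v = 0) ∧
        ∀ i, B i v v = t i := by
    intro j
    induction j with
    | zero =>
      intro _
      refine ⟨⊥, ∅, by simp, by simp, fun t ht => ⟨0, by simp, by simp, ?_⟩⟩
      rw [Submodule.mem_bot] at ht
      simp [ht]
    | succ j ih =>
      intro hj
      obtain ⟨E, G, hG, hE, hEG⟩ := ih (by omega)
      by_cases htop : E = ⊤
      · exact ⟨E, G, by omega, by rw [htop, finrank_top]; simpa using hj, hEG⟩
      obtain ⟨φ, hφ, hEφ⟩ := Submodule.exists_le_ker_of_lt_top E (lt_top_iff_ne_top.mpr htop)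
      have hφs : ∀ x, φ x = ∑ i, φ (Pi.single i 1) * x i := by
        intro x
        conv_lhs => rw [pi_eq_sum_univ' x]
        simp [mul_comm]
      obtain ⟨v₀, hv₀, hne⟩ := h (fun i => φ (Pi.single i 1)) (by
        intro hc
        refine hφ (LinearMap.ext fun x => ?_)
        rw [hφs]
        simp [fun i => congrFun hc i]) (F ∪ G) (by
        refine le_trans (Nat.mul_le_mul_left _ ?_) hF
        exact (Finset.card_union_le _ _).trans (by omega))
      let q : Fin r → ℂ := fun i => B i v₀ v₀
      have hq : q ∉ E := fun hq => hne (by rw [← hφs q]; exact hEφ hq)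
      refine ⟨E ⊔ Submodule.span ℂ {q}, insert v₀ G, (Finset.card_insert_le _ _).trans (by omega),
        ?_, ?_⟩
      · refine lt_of_le_of_lt hE (Submodule.finrank_lt_finrank_of_lt ?_)
        refine lt_of_le_of_ne le_sup_left fun heq => hq ?_
        rw [heq]
        exact Submodule.mem_sup_right (Submodule.mem_span_singleton_self _)
      · intro t ht
        obtain ⟨e, he, b, hb, rfl⟩ := Submodule.mem_sup.mp ht
        obtain ⟨a, rfl⟩ := Submodule.mem_span_singleton.mp hb
        obtain ⟨v, hv, hvF, hve⟩ := hEG e he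
        obtain ⟨s, hs⟩ := IsAlgClosed.exists_pow_nat_eq a two_pos
        have horth : ∀ i, B i v v₀ = 0 := by
          intro i
          have : Submodule.span ℂ (G : Set V) ≤ LinearMap.ker ((B i).flip v₀) := by
            rw [Submodule.span_le]
            intro u hu
            simpa using hv₀ u (Finset.mem_union_right _ hu) i
          simpa using this hv
        refine ⟨v + s • v₀, ?_, fun u hu i => ?_, fun i => ?_⟩
        · refine add_mem (Submodule.span_mono (by simp) hv)
            (Submodule.smul_mem _ _ (Submodule.subset_span (by simp)))
        · simp [hvF u hu i, hv₀ u (Finset.mem_union_left _ hu) i]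
        · simp only [map_add, LinearMap.add_apply, map_smul, LinearMap.smul_apply, hve, horth,
            hB i v₀ v, smul_eq_mul, Pi.add_apply, Pi.smul_apply, q, ← hs]
          ring
  obtain ⟨E, G, -, hE, hEG⟩ := key r le_rfl
  have htop : E = ⊤ := Submodule.eq_top_of_finrank_eq
    (le_antisymm (Submodule.finrank_le E) (by simpa using hE))
  obtain ⟨v, -, hv⟩ := hEG t (htop ▸ Submodule.mem_top)
  exact ⟨v, hv⟩

lemma IsAnisotropicFamily.exists_orthogonal {r : ℕ} {V : Type*} [AddCommGroup V] [Module ℂ V]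
    {B : Fin r → LinearMap.BilinForm ℂ V} (hB : ∀ i x y, B i x y = B i y x)
    (h : IsAnisotropicFamily (r * (r + r)) B) :
    ∃ w : Fin r → V, ∀ i j k, B i (w j) (w k) = if j = k ∧ i = j then 1 else 0 := by
  classical
  suffices hS : ∀ S : Finset (Fin r), ∃ w : Fin r → V, ∀ i, ∀ j ∈ S, ∀ k ∈ S,
      B i (w j) (w k) = if j = k ∧ i = j then 1 else 0 by
    obtain ⟨w, hw⟩ := hS Finset.univ
    exact ⟨w, fun i j k => hw i j (Finset.mem_univ _) k (Finset.mem_univ _)⟩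
  intro S
  induction S using Finset.induction_on with
  | empty => exact ⟨0, by simp⟩
  | insert a S ha ih =>
    obtain ⟨w, hw⟩ := ih
    obtain ⟨v, hv, hva⟩ := h.exists_apply_eq hB (S.image w) (by
      gcongr
      exact Finset.card_image_le.trans (card_finset_fin_le S)) (Pi.single a 1)
    have hv' : ∀ j ∈ S, ∀ i, B i (w j) v = 0 := fun j hj i => hv _ (Finset.mem_image_of_mem _ hj) i
    refine ⟨Function.update w a v, fun i j hj k hk => ?_⟩
    rw [Finset.mem_insert] at hj hk
    have hne : ∀ j ∈ S, j ≠ a := fun j hj h => ha (h ▸ hj)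
    rcases hj with rfl | hj <;> rcases hk with rfl | hk
    · simp [hva, Pi.single_apply]
    · simp [hne k hk, (hne k hk).symm, hB i v, hv' k hk]
    · simp [hne j hj, hv' j hj]
    · simp [hne j hj, hne k hk, hw i j hj k hk]

lemma isAnisotropicFamily_of_not_isSumOfProducts {r n N : ℕ} {Q : Fin r → MvPolynomial (Fin n) ℂ}
    {B : Fin r → LinearMap.BilinForm ℂ (Fin n → ℂ)} (hB : ∀ i x y, B i x y = B i y x)
    (hQ : ∀ i x, eval x (Q i) = B i x x)
    (h : ∀ c : Fin r → ℂ, c ≠ 0 → ¬ IsSumOfProducts N (∑ i, c i • Q i)) :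
    IsAnisotropicFamily N B := by
  intro c hc F hF
  by_contra! hne
  refine h c hc (isSumOfProducts_of_forall_eval_eq_zero (ι := Fin r × F) (by simpa using hF)
    (∑ i, c i • B i) (fun x y => ?_) (fun x => ?_) (fun k => B k.1 k.2) fun x hx => ?_)
  · simp [hB _ x y]
  · simp [hQ, smul_eval]
  · simpa using hne x fun u hu i => hx (i, ⟨u, hu⟩)

/-- Polynomials in `r + 1` variables with coefficients in the polynomial ring `ℂ[x₁, …, xₙ]`. -/
abbrev PolyOver (r n : ℕ) : Type :=
  MvPolynomial (Option (Fin r)) (MvPolynomial (Fin n) ℂ)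

lemma mem_span_of_mul_mem_span_s12 {r n : ℕ} {Q : Fin r → MvPolynomial (Fin n) ℂ}
    (hQ : ∀ i, (Q i).IsHomogeneous 2) {M : Fin r → Matrix (Fin n) (Fin n) ℂ}
    (hM : ∀ i, Q i = ∑ a, ∑ b, C (M i a b) * (X a * X b)) {w : Fin r → Fin n → ℂ}
    (hw : ∀ i j k, (M i).toBilin' (w j) (w k) = if j = k ∧ i = j then 1 else 0) (k : Fin r)
    {f : MvPolynomial (Fin n) ℂ} (hf : Q k * f ∈ Ideal.span (Q '' {j | j < k})) :
    f ∈ Ideal.span (Q '' {j | j < k}) := by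
  let Y : Fin n → PolyOver r n := fun a => ∑ j, C (C (w j a)) * X (some j)
  let φ : MvPolynomial (Fin n) ℂ →ₐ[ℂ] PolyOver r n := aeval fun a => C (X a) * X none + Y a
  let ρ : PolyOver r n →ₐ[MvPolynomial (Fin n) ℂ] MvPolynomial (Fin n) ℂ :=
    aeval fun o => o.elim 1 0
  have hρφ : ∀ g, ρ (φ g) = g := by
    have : (ρ.restrictScalars ℂ).comp φ = AlgHom.id ℂ (MvPolynomial (Fin n) ℂ) := by
      refine MvPolynomial.algHom_ext fun a => ?_
      simp [φ, ρ, Y]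
    exact fun g => DFunLike.congr_fun this g
  have hC : ∀ c : ℂ, algebraMap ℂ (PolyOver r n) c = C (C c) := fun _ => rfl
  have hY : ∀ i, aeval Y (Q i) = (X (some i) ^ 2 : PolyOver r n) := by
    intro i
    have h1 : aeval Y (Q i) =
        ∑ j, ∑ k, (C (C ((M i).toBilin' (w j) (w k))) * (X (some j) * X (some k)) :
          PolyOver r n) := by
      simp only [Matrix.toBilin'_apply, hM i, map_sum, map_mul, aeval_X, aeval_C, hC, Y,
        Finset.mul_sum, Finset.sum_mul]
      refine (Finset.sum_congr rfl fun _ _ => Finset.sum_comm).trans (Finset.sum_comm.trans ?_)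
      refine (Finset.sum_congr rfl fun _ _ => (Finset.sum_congr rfl fun _ _ =>
        Finset.sum_comm).trans Finset.sum_comm).trans (Finset.sum_comm.trans ?_)
      refine Finset.sum_congr rfl fun j _ => Finset.sum_congr rfl fun k _ =>
        Finset.sum_congr rfl fun a _ => Finset.sum_congr rfl fun b _ => ?_
      ring
    rw [h1, Finset.sum_eq_single i, Finset.sum_eq_single i]
    · simp [hw, pow_two]
    · intro k _ hk
      simp [hw, hk.symm]
    · simp
    · intro j _ hj
      simp [hw, hj.symm]
    · simp
  have hmod : ∀ i, φ (Q i) - X (some i) ^ 2 ∈ Ideal.span {(X none : PolyOver r n)} := by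
    intro i
    rw [← hY, ← Ideal.Quotient.eq]
    have : (Ideal.Quotient.mkₐ ℂ (Ideal.span {(X none : PolyOver r n)})).comp φ =
        (Ideal.Quotient.mkₐ ℂ (Ideal.span {(X none : PolyOver r n)})).comp (aeval Y) := by
      refine MvPolynomial.algHom_ext fun a => ?_
      simp only [AlgHom.comp_apply, φ, aeval_X, Ideal.Quotient.mkₐ_eq_mk, Ideal.Quotient.eq,
        add_sub_cancel_right]
      exact Ideal.mul_mem_left _ _ (Ideal.mem_span_singleton_self _)
    exact DFunLike.congr_fun this (Q i)
  have hhom : ∀ i, (φ (Q i)).IsHomogeneous 2 := by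
    intro i
    refine (hQ i).aeval (n := 1) _ fun a => ?_
    exact (isHomogeneous_C_mul_X _ _).add
      (IsHomogeneous.sum _ _ _ fun j _ => isHomogeneous_C_mul_X _ _)
  have h1 : φ (Q k) * φ f ∈ Ideal.span ((fun j => φ (Q j)) '' {j | j < k}) := by
    have := Ideal.mem_map_of_mem φ hf
    rwa [map_mul, Ideal.map_span, Set.image_image] at this
  have h2 := Ideal.mem_map_of_mem ρ (regular_of_sub_X_sq_mem hhom hmod k h1)
  rw [Ideal.map_span, Set.image_image] at h2
  simpa only [hρφ] using h2

theorem stmt12 (r : ℕ) (hr : 0 < r) :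
    ∃ N : ℕ, 0 < N ∧
      ∀ (n : ℕ), 0 < n → ∀ Q : Fin r → MvPolynomial (Fin n) ℂ,
        (∀ i, (Q i).IsHomogeneous 2) →
        -- collective strength at least `N`: no nontrivial `ℂ`-linear combination
        -- is a sum of `N` products of homogeneous polynomials of positive degree
        (∀ c : Fin r → ℂ, c ≠ 0 → ¬ IsSumOfProducts N (∑ i, c i • Q i)) →
        RingTheory.Sequence.IsRegular (MvPolynomial (Fin n) ℂ)
          ((List.finRange r).map Q) := by
  refine ⟨r * (r + r), by positivity, fun n _ Q hQ hstr => ?_⟩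
  choose M hMs hM using fun i => exists_symmetric_matrix_of_isHomogeneous_two (hQ i)
  have hB : ∀ i x y, (M i).toBilin' x y = (M i).toBilin' y x := by
    intro i x y
    rw [Matrix.toBilin'_apply, Matrix.toBilin'_apply, Finset.sum_comm]
    refine Finset.sum_congr rfl fun a _ => Finset.sum_congr rfl fun b _ => ?_
    rw [(hMs i).apply]
    ring
  have heval : ∀ i x, eval x (Q i) = (M i).toBilin' x x := by
    intro i x
    rw [Matrix.toBilin'_apply, hM i]
    simp only [map_sum, map_mul, eval_C, eval_X]
    refine Finset.sum_congr rfl fun a _ => Finset.sum_congr rfl fun b _ => ?_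
    ring
  obtain ⟨w, hw⟩ :=
    (isAnisotropicFamily_of_not_isSumOfProducts hB heval hstr).exists_orthogonal hB
  refine ⟨⟨fun i hi => ?_⟩, ?_⟩
  · have hir : i < r := by simpa using hi
    have hspan : Ideal.ofList (((List.finRange r).map Q).take i) =
        Ideal.span (Q '' {j | j < ⟨i, hir⟩}) := by
      rw [Ideal.ofList, ← List.map_take]
      congr 1
      ext p
      simp [List.mem_take_iff_getElem, Fin.lt_def]
      constructor
      · rintro ⟨j, hj, rfl⟩
        exact ⟨⟨j, hj.2⟩, hj.1, rfl⟩
      · rintro ⟨j, hj, rfl⟩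
        exact ⟨j, ⟨hj, j.2⟩, rfl⟩
    rw [isSMulRegular_quotient_iff_mem_of_smul_mem, smul_eq_mul, Ideal.mul_top, hspan]
    intro f hf
    exact mem_span_of_mul_mem_span_s12 hQ hM hw ⟨i, hir⟩ (by simpa using hf)
  · rw [smul_eq_mul, Ideal.mul_top]
    intro h
    have hle : Ideal.ofList ((List.finRange r).map Q) ≤
        RingHom.ker (constantCoeff (σ := Fin n) (R := ℂ)) := by
      rw [Ideal.ofList, Ideal.span_le]
      intro p hp
      obtain ⟨i, -, rfl⟩ := List.mem_map.mp hp
      exact (hQ i).coeff_eq_zero (by simp)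
    have := hle (h ▸ Submodule.mem_top : (1 : MvPolynomial (Fin n) ℂ) ∈ _)
    simp at this
end
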